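/- arXiv:1203.0895 — 11 statements merged into one kernel-verified Lean document; each statement's English description precedes it below -/
import Mathlib

section
/- The extended-real-valued functions ĉ₊ and ĉ₋ are nondecreasing on O. If moreover for each d ∈ O there exist c₁, c₂ ∈ ℝ with w(c₁,d) > −q⁺ and w(c₂,d) < q⁻, then for every d ∈ O one has ĉ₊(d) < +∞, ĉ₋(d) > −∞, and the strict inequality ĉ₊(d) < ĉ₋(d) holds in the extended reals. -/
/-- Proposition 3.5(1) of Federico–Pham.
With the setting of Proposition 3.5 (`w = v_c` continuous on `ℝ × O`, nondecreasing in `c`,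
nonincreasing in `d`, bounded by `-qp ≤ w ≤ qm`), the extended-real-valued boundary
functions `ĉ₊(d) = sSup {c | w c d = -qp}` and `ĉ₋(d) = sInf {c | w c d = qm}` are
nondecreasing on `O`; and if for each `d ∈ O` there are `c₁, c₂` with `w c₁ d > -qp` and
`w c₂ d < qm`, then `ĉ₊(d) < ⊤`, `⊥ < ĉ₋(d)` and `ĉ₊(d) < ĉ₋(d)` for every `d ∈ O`. -/
theorem stmt1
    (O : Set ℝ) (hO : IsOpen O) (hOc : O.OrdConnected)
    (qp qm : ℝ) (hqp : 0 < qp) (hqm : 0 < qm)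
    (w : ℝ → ℝ → ℝ)
    (hwcont : ContinuousOn (fun p : ℝ × ℝ => w p.1 p.2) (Set.univ ×ˢ O))
    (hwmono : ∀ d ∈ O, Monotone (fun c => w c d))
    (hwanti : ∀ c : ℝ, AntitoneOn (fun d => w c d) O)
    (hwbdd : ∀ c : ℝ, ∀ d ∈ O, -qp ≤ w c d ∧ w c d ≤ qm)
    (chatp chatm : ℝ → EReal)
    (hchatp : ∀ d : ℝ, chatp d = sSup ((fun c : ℝ => (c : EReal)) '' {c : ℝ | w c d = -qp}))
    (hchatm : ∀ d : ℝ, chatm d = sInf ((fun c : ℝ => (c : EReal)) '' {c : ℝ | w c d = qm})) :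
    MonotoneOn chatp O ∧ MonotoneOn chatm O ∧
    ((∀ d ∈ O, ∃ c₁ c₂ : ℝ, -qp < w c₁ d ∧ w c₂ d < qm) →
      ∀ d ∈ O, chatp d < ⊤ ∧ ⊥ < chatm d ∧ chatp d < chatm d) := by
  have up : ∀ d ∈ O, ∀ a : ℝ, -qp < w a d → chatp d ≤ (a : EReal) := by
    intro d hd a ha
    rw [hchatp]
    apply sSup_le
    rintro _ ⟨c, hc, rfl⟩
    have hc' : w c d = -qp := hc
    refine EReal.coe_le_coe_iff.2 ?_
    by_contra! h
    have h2 : w a d ≤ w c d := hwmono d hd h.le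
    linarith
  have um : ∀ d ∈ O, ∀ b : ℝ, w b d < qm → (b : EReal) ≤ chatm d := by
    intro d hd a ha
    rw [hchatm]
    apply le_sInf
    rintro _ ⟨c, hc, rfl⟩
    have hc' : w c d = qm := hc
    refine EReal.coe_le_coe_iff.2 ?_
    by_contra! h
    have h2 : w c d ≤ w a d := hwmono d hd h.le
    linarith
  refine ⟨?_, ?_, ?_⟩
  · intro d₁ h₁ d₂ h₂ h
    rw [hchatp, hchatp]
    apply sSup_le_sSup
    apply Set.image_mono
    intro c hc
    have hc' : w c d₁ = -qp := hc
    have h3 : w c d₂ ≤ w c d₁ := hwanti c h₁ h₂ h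
    exact le_antisymm (h3.trans hc'.le) (hwbdd c d₂ h₂).1
  · intro d₁ h₁ d₂ h₂ h
    rw [hchatm, hchatm]
    apply sInf_le_sInf
    apply Set.image_mono
    intro c hc
    have hc' : w c d₂ = qm := hc
    have h3 : w c d₂ ≤ w c d₁ := hwanti c h₁ h₂ h
    exact le_antisymm (hwbdd c d₁ h₁).2 (hc'.ge.trans h3)
  · intro H d hd
    obtain ⟨c₁, c₂, h₁, h₂⟩ := H d hd
    refine ⟨(up d hd c₁ h₁).trans_lt (EReal.coe_lt_top _),
      (EReal.bot_lt_coe _).trans_le (um d hd c₂ h₂), ?_⟩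
    have hcont : Continuous (fun c => w c d) :=
      hwcont.comp_continuous (f := fun c : ℝ => (c, d)) (by fun_prop)
        (fun c => ⟨Set.mem_univ _, hd⟩)
    have hex : ∃ c, -qp < w c d ∧ w c d < qm := by
      by_cases ha : w c₁ d < qm
      · exact ⟨c₁, h₁, ha⟩
      by_cases hb : -qp < w c₂ d
      · exact ⟨c₂, hb, h₂⟩
      obtain ⟨c, hc⟩ := mem_range_of_exists_le_of_exists_ge (c := (0 : ℝ)) hcont
        ⟨c₂, by linarith⟩ ⟨c₁, by linarith⟩
      have hc' : w c d = 0 := hc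
      exact ⟨c, by linarith, by linarith⟩
    obtain ⟨c, hc1, hc2⟩ := hex
    have hopen : IsOpen {x : ℝ | w x d < qm} := isOpen_lt hcont continuous_const
    obtain ⟨ε, hε, hball⟩ := Metric.isOpen_iff.1 hopen c hc2
    have hb : w (c + ε / 2) d < qm := hball (by
      rw [Metric.mem_ball, Real.dist_eq, add_sub_cancel_left, abs_of_pos (by positivity)]
      linarith)
    calc chatp d ≤ (c : EReal) := up d hd c hc1
      _ < ((c + ε / 2 : ℝ) : EReal) := EReal.coe_lt_coe_iff.2 (by linarith)
      _ ≤ chatm d := um d hd _ hb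
end

section
/- The function ĉ₊ is right-continuous and ĉ₋ is left-continuous; precisely, for every d ∈ O: ĉ₊(d) = ⨅ {ĉ₊(d') | d' ∈ O, d' > d} and ĉ₋(d) = ⨆ {ĉ₋(d') | d' ∈ O, d' < d}, where infimum and supremum are taken in the extended reals. -/
/-- Proposition 3.5(2) of Federico–Pham.
With the setting of Proposition 3.5 (`w = v_c` continuous on `ℝ × O`, nondecreasing in `c`,
nonincreasing in `d`, bounded by `-qp ≤ w ≤ qm`), the boundary function
`ĉ₊(d) = sSup {c | w c d = -qp}` is right-continuous and `ĉ₋(d) = sInf {c | w c d = qm}` is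
left-continuous; precisely, for every `d ∈ O`,
`ĉ₊(d) = sInf {ĉ₊ d' | d' ∈ O, d < d'}` and `ĉ₋(d) = sSup {ĉ₋ d' | d' ∈ O, d' < d}`
(infimum and supremum in the extended reals). -/
theorem stmt2
    (O : Set ℝ) (hO : IsOpen O) (hOc : O.OrdConnected)
    (qp qm : ℝ) (hqp : 0 < qp) (hqm : 0 < qm)
    (w : ℝ → ℝ → ℝ)
    (hwcont : ContinuousOn (fun p : ℝ × ℝ => w p.1 p.2) (Set.univ ×ˢ O))
    (hwmono : ∀ d ∈ O, Monotone (fun c => w c d))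
    (hwanti : ∀ c : ℝ, AntitoneOn (fun d => w c d) O)
    (hwbdd : ∀ c : ℝ, ∀ d ∈ O, -qp ≤ w c d ∧ w c d ≤ qm)
    (chatp chatm : ℝ → EReal)
    (hchatp : ∀ d : ℝ, chatp d = sSup ((fun c : ℝ => (c : EReal)) '' {c : ℝ | w c d = -qp}))
    (hchatm : ∀ d : ℝ, chatm d = sInf ((fun c : ℝ => (c : EReal)) '' {c : ℝ | w c d = qm})) :
    ∀ d ∈ O,
      chatp d = sInf (chatp '' {d' ∈ O | d < d'}) ∧
      chatm d = sSup (chatm '' {d' ∈ O | d' < d}) := by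
  intro d hd
  have hcont : ∀ c : ℝ, ContinuousAt (fun x => w c x) d := by
    intro c
    have h1 : ContinuousAt (fun p : ℝ × ℝ => w p.1 p.2) (c, d) :=
      hwcont.continuousAt ((isOpen_univ.prod hO).mem_nhds ⟨Set.mem_univ _, hd⟩)
    have h2 : ContinuousAt (fun x : ℝ => (c, x)) d := by fun_prop
    exact ContinuousAt.comp (f := fun x : ℝ => (c, x)) (x := d) h1 h2
  have hOd : O ∈ nhds d := hO.mem_nhds hd
  constructor
  · apply le_antisymm
    · apply le_sInf
      rintro _ ⟨d', ⟨hd', hlt⟩, rfl⟩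
      rw [hchatp, hchatp]
      apply sSup_le_sSup
      apply Set.image_mono
      intro c hc
      have h1 := hwanti c hd hd' hlt.le
      have h2 := (hwbdd c d' hd').1
      simp only [Set.mem_ofPred_eq] at hc h1 ⊢
      linarith
    · by_contra! hcon
      obtain ⟨c, hc1, hc2⟩ := EReal.lt_iff_exists_real_btwn.1 hcon
      have key : ∀ d' ∈ O, d < d' → w c d' = -qp := by
        intro d' hd' hlt
        have h1 : (c : EReal) < chatp d' := hc2.trans_le (sInf_le ⟨d', ⟨hd', hlt⟩, rfl⟩)
        rw [hchatp, lt_sSup_iff] at h1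
        obtain ⟨_, ⟨c', hc', rfl⟩, hcc⟩ := h1
        have h3 := hwmono d' hd' (EReal.coe_lt_coe_iff.1 hcc).le
        have h2 := (hwbdd c d' hd').1
        simp only [Set.mem_ofPred_eq] at hc' h3
        linarith
      have hw : w c d = -qp := by
        have ht : Filter.Tendsto (fun x => w c x) (nhdsWithin d (Set.Ioi d)) (nhds (w c d)) :=
          (hcont c).tendsto.mono_left nhdsWithin_le_nhds
        refine tendsto_nhds_unique ht (tendsto_const_nhds.congr' ?_)
        filter_upwards [self_mem_nhdsWithin, mem_nhdsWithin_of_mem_nhds hOd] with x hx hxO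
        exact (key x hxO hx).symm
      have : (c : EReal) ≤ chatp d := by
        rw [hchatp]
        exact le_sSup ⟨c, hw, rfl⟩
      exact absurd hc1 (not_lt.2 this)
  · apply le_antisymm
    · by_contra! hcon
      obtain ⟨c, hc1, hc2⟩ := EReal.lt_iff_exists_real_btwn.1 hcon
      have key : ∀ d' ∈ O, d' < d → w c d' = qm := by
        intro d' hd' hlt
        have hm : d' ∈ {d' ∈ O | d' < d} := ⟨hd', hlt⟩
        have h1 : chatm d' < (c : EReal) :=
          lt_of_le_of_lt (le_sSup (Set.mem_image_of_mem chatm hm)) hc1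
        rw [hchatm, sInf_lt_iff] at h1
        obtain ⟨_, ⟨c', hc', rfl⟩, hcc⟩ := h1
        have h3 := hwmono d' hd' (EReal.coe_lt_coe_iff.1 hcc).le
        have h2 := (hwbdd c d' hd').2
        simp only [Set.mem_ofPred_eq] at hc' h3
        linarith
      have hw : w c d = qm := by
        have ht : Filter.Tendsto (fun x => w c x) (nhdsWithin d (Set.Iio d)) (nhds (w c d)) :=
          (hcont c).tendsto.mono_left nhdsWithin_le_nhds
        refine tendsto_nhds_unique ht (tendsto_const_nhds.congr' ?_)
        filter_upwards [self_mem_nhdsWithin, mem_nhdsWithin_of_mem_nhds hOd] with x hx hxO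
        exact (key x hxO hx).symm
      have : chatm d ≤ (c : EReal) := by
        rw [hchatm]
        exact sInf_le ⟨c, hw, rfl⟩
      exact absurd hc2 (not_lt.2 this)
    · apply sSup_le
      rintro _ ⟨d', ⟨hd', hlt⟩, rfl⟩
      rw [hchatm, hchatm]
      apply sInf_le_sInf
      apply Set.image_mono
      intro c hc
      have h1 := hwanti c hd' hd hlt.le
      have h2 := (hwbdd c d' hd').2
      simp only [Set.mem_ofPred_eq] at hc h1 ⊢
      linarith
end

section
/- For every c ∈ ℝ and d ∈ O one has: w(c,d) = −q⁺ if and only if (d : extended real) ≥ d̂₊(c); and w(c,d) = q⁻ if and only if (d : extended real) ≤ d̂₋(c). Consequently −q⁺ < w(c,d) < q⁻ if and only if d̂₋(c) < d < d̂₊(c) in the extended reals, so the d-section of the continuation region is the interval (d̂₋(c), d̂₊(c)) ∩ O. Moreover the functions d̂₊ and d̂₋ are nondecreasing on ℝ. -/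
/-- Propositions 3.6(1)-(2) and 3.7 of Federico–Pham.
With the setting of Section 3 (`w = v_c` continuous on `ℝ × O`, nondecreasing in `c`,
nonincreasing in `d`, bounded by `-qp ≤ w ≤ qm`), define the pseudo-inverse boundaries
`d̂₊(c) = sInf {d ∈ O | w c d = -qp}` and `d̂₋(c) = sSup {d ∈ O | w c d = qm}` in the
extended reals. Then for every `c ∈ ℝ` and `d ∈ O`:
`w c d = -qp ↔ d̂₊(c) ≤ d`, `w c d = qm ↔ d ≤ d̂₋(c)`, hence
`-qp < w c d < qm ↔ d̂₋(c) < d < d̂₊(c)`; consequently the `c`-section of the continuation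
region is `{d ∈ O | d̂₋(c) < d < d̂₊(c)}`; moreover `d̂₊` and `d̂₋` are nondecreasing. -/
theorem stmt3
    (O : Set ℝ) (hO : IsOpen O) (hOc : O.OrdConnected)
    (qp qm : ℝ) (hqp : 0 < qp) (hqm : 0 < qm)
    (w : ℝ → ℝ → ℝ)
    (hwcont : ContinuousOn (fun p : ℝ × ℝ => w p.1 p.2) (Set.univ ×ˢ O))
    (hwmono : ∀ d ∈ O, Monotone (fun c => w c d))
    (hwanti : ∀ c : ℝ, AntitoneOn (fun d => w c d) O)
    (hwbdd : ∀ c : ℝ, ∀ d ∈ O, -qp ≤ w c d ∧ w c d ≤ qm)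
    (dhatp dhatm : ℝ → EReal)
    (hdhatp : ∀ c : ℝ, dhatp c = sInf ((fun d : ℝ => (d : EReal)) '' {d ∈ O | w c d = -qp}))
    (hdhatm : ∀ c : ℝ, dhatm c = sSup ((fun d : ℝ => (d : EReal)) '' {d ∈ O | w c d = qm})) :
    (∀ c : ℝ, ∀ d ∈ O,
      (w c d = -qp ↔ dhatp c ≤ (d : EReal)) ∧
      (w c d = qm ↔ (d : EReal) ≤ dhatm c) ∧
      ((-qp < w c d ∧ w c d < qm) ↔ (dhatm c < (d : EReal) ∧ (d : EReal) < dhatp c))) ∧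
    (∀ c : ℝ, {d ∈ O | -qp < w c d ∧ w c d < qm}
        = {d ∈ O | dhatm c < (d : EReal) ∧ (d : EReal) < dhatp c}) ∧
    Monotone dhatp ∧ Monotone dhatm := by
  have hcont : ∀ c : ℝ, ∀ d ∈ O, ContinuousAt (fun x => w c x) d := by
    intro c d hd
    have h1 : ContinuousAt (fun p : ℝ × ℝ => w p.1 p.2) (c, d) :=
      hwcont.continuousAt ((isOpen_univ.prod hO).mem_nhds ⟨Set.mem_univ _, hd⟩)
    have h2 : ContinuousAt (fun x : ℝ => (c, x)) d := by fun_prop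
    exact ContinuousAt.comp (f := fun x : ℝ => (c, x)) h1 h2
  have hp : ∀ c : ℝ, ∀ d ∈ O, (w c d = -qp ↔ dhatp c ≤ (d : EReal)) := by
    intro c d hd
    rw [hdhatp]
    constructor
    · intro h
      exact sInf_le ⟨d, ⟨hd, h⟩, rfl⟩
    · intro h
      by_contra hne
      have hlt : -qp < w c d := lt_of_le_of_ne (hwbdd c d hd).1 (Ne.symm hne)
      have hev := ((hcont c d hd).eventually (lt_mem_nhds hlt)).and (hO.mem_nhds hd)
      obtain ⟨e, ⟨he1, he2⟩, he3⟩ :=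
        ((hev.filter_mono (nhdsWithin_le_nhds (s := Set.Ioi d))).and
          self_mem_nhdsWithin).exists
      have hle : (e : EReal) ≤ sInf ((fun d : ℝ => (d : EReal)) '' {d ∈ O | w c d = -qp}) := by
        apply le_sInf
        rintro _ ⟨x, ⟨hx, hxw⟩, rfl⟩
        apply EReal.coe_le_coe_iff.2
        by_contra! hxe
        have := hwanti c hx he2 hxe.le
        simp only at this he1
        linarith
      have h3 := EReal.coe_le_coe_iff.1 (hle.trans h)
      exact absurd h3 (not_le.2 he3)
  have hm : ∀ c : ℝ, ∀ d ∈ O, (w c d = qm ↔ (d : EReal) ≤ dhatm c) := by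
    intro c d hd
    rw [hdhatm]
    constructor
    · intro h
      exact le_sSup ⟨d, ⟨hd, h⟩, rfl⟩
    · intro h
      by_contra hne
      have hlt : w c d < qm := lt_of_le_of_ne (hwbdd c d hd).2 hne
      have hev := ((hcont c d hd).eventually (gt_mem_nhds hlt)).and (hO.mem_nhds hd)
      obtain ⟨e, ⟨he1, he2⟩, he3⟩ :=
        ((hev.filter_mono (nhdsWithin_le_nhds (s := Set.Iio d))).and
          self_mem_nhdsWithin).exists
      have hle : sSup ((fun d : ℝ => (d : EReal)) '' {d ∈ O | w c d = qm}) ≤ (e : EReal) := by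
        apply sSup_le
        rintro _ ⟨x, ⟨hx, hxw⟩, rfl⟩
        apply EReal.coe_le_coe_iff.2
        by_contra! hxe
        have := hwanti c he2 hx hxe.le
        simp only at this he1
        linarith
      have h3 := EReal.coe_le_coe_iff.1 (h.trans hle)
      exact absurd h3 (not_le.2 he3)
  have hb : ∀ c : ℝ, ∀ d ∈ O, ((-qp < w c d ∧ w c d < qm) ↔
      (dhatm c < (d : EReal) ∧ (d : EReal) < dhatp c)) := by
    intro c d hd
    rw [← not_le, ← not_le, ← not_le (a := dhatp c), ← not_le (b := dhatm c),
      ← hp c d hd, ← hm c d hd]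
    have h := hwbdd c d hd
    constructor
    · rintro ⟨h1, h2⟩
      exact ⟨fun h3 => h2 h3.ge, fun h3 => h1 h3.le⟩
    · rintro ⟨h1, h2⟩
      exact ⟨fun h3 => h2 (le_antisymm h3 h.1), fun h3 => h1 (le_antisymm h.2 h3)⟩
  refine ⟨fun c d hd => ⟨hp c d hd, hm c d hd, hb c d hd⟩, ?_, ?_, ?_⟩
  · intro c
    ext d
    exact and_congr_right (hb c d)
  · intro a b hab
    rw [hdhatp, hdhatp]
    apply sInf_le_sInf
    apply Set.image_mono
    rintro x ⟨hx, hxw⟩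
    have h1 := hwmono x hx hab
    exact ⟨hx, le_antisymm (h1.trans hxw.le) (hwbdd a x hx).1⟩
  · intro a b hab
    rw [hdhatm, hdhatm]
    apply sSup_le_sSup
    apply Set.image_mono
    rintro x ⟨hx, hxw⟩
    have h1 := hwmono x hx hab
    exact ⟨hx, le_antisymm (hwbdd b x hx).2 (hxw.ge.trans h1)⟩
end

section
/- The set A⁺ := {(c,d) ∈ ℝ × O | w(c,d) = −q⁺} is closed in ℝ × O and, if nonempty, path-connected; the set A⁻ := {(c,d) ∈ ℝ × O | w(c,d) = q⁻} is closed in ℝ × O and, if nonempty, path-connected; and the set C := {(c,d) ∈ ℝ × O | −q⁺ < w(c,d) < q⁻} is open in ℝ × O. -/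
theorem aux_down (O : Set ℝ) (hOc : O.OrdConnected) (S : Set (ℝ × ℝ)) (hSO : ∀ p ∈ S, p.2 ∈ O)
    (h : ∀ p ∈ S, ∀ a b : ℝ, a ≤ p.1 → p.2 ≤ b → b ∈ O → (a, b) ∈ S) (hne : S.Nonempty) :
    IsPathConnected S := by
  have key : ∀ p ∈ S, ∀ a b : ℝ, a ≤ p.1 → p.2 ≤ b → b ∈ O → JoinedIn S p (a, b) := by
    intro p hp a b ha hb hbO
    apply JoinedIn.of_segment_subset
    have hc : Convex ℝ (Set.Icc a p.1 ×ˢ Set.Icc p.2 b) := (convex_Icc _ _).prod (convex_Icc _ _)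
    refine (hc.segment_subset (x := p) (y := (a, b)) ⟨⟨ha, le_rfl⟩, ⟨le_rfl, hb⟩⟩
      ⟨⟨le_rfl, ha⟩, ⟨hb, le_rfl⟩⟩).trans ?_
    rintro ⟨x, y⟩ ⟨hx, hy⟩
    exact h p hp x y hx.2 hy.1 (hOc.out (hSO p hp) hbO hy)
  rw [isPathConnected_iff]
  refine ⟨hne, fun p hp q hq => ?_⟩
  have hm : max p.2 q.2 ∈ O := by
    rcases max_choice p.2 q.2 with e | e <;> rw [e]
    exacts [hSO p hp, hSO q hq]
  exact (key p hp (min p.1 q.1) _ (min_le_left _ _) (le_max_left _ _) hm).trans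
    (key q hq _ _ (min_le_right _ _) (le_max_right _ _) hm).symm

theorem aux_up (O : Set ℝ) (hOc : O.OrdConnected) (S : Set (ℝ × ℝ)) (hSO : ∀ p ∈ S, p.2 ∈ O)
    (h : ∀ p ∈ S, ∀ a b : ℝ, p.1 ≤ a → b ≤ p.2 → b ∈ O → (a, b) ∈ S) (hne : S.Nonempty) :
    IsPathConnected S := by
  have key : ∀ p ∈ S, ∀ a b : ℝ, p.1 ≤ a → b ≤ p.2 → b ∈ O → JoinedIn S p (a, b) := by
    intro p hp a b ha hb hbO
    apply JoinedIn.of_segment_subset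
    have hc : Convex ℝ (Set.Icc p.1 a ×ˢ Set.Icc b p.2) := (convex_Icc _ _).prod (convex_Icc _ _)
    refine (hc.segment_subset (x := p) (y := (a, b)) ⟨⟨le_rfl, ha⟩, ⟨hb, le_rfl⟩⟩
      ⟨⟨ha, le_rfl⟩, ⟨le_rfl, hb⟩⟩).trans ?_
    rintro ⟨x, y⟩ ⟨hx, hy⟩
    exact h p hp x y hx.1 hy.2 (hOc.out hbO (hSO p hp) hy)
  rw [isPathConnected_iff]
  refine ⟨hne, fun p hp q hq => ?_⟩
  have hm : min p.2 q.2 ∈ O := by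
    rcases min_choice p.2 q.2 with e | e <;> rw [e]
    exacts [hSO p hp, hSO q hq]
  exact (key p hp (max p.1 q.1) _ (le_max_left _ _) (min_le_left _ _) hm).trans
    (key q hq _ _ (le_max_right _ _) (min_le_right _ _) hm).symm

/-- Proposition 3.5(4) of Federico–Pham.
With the setting of Section 3 (`w = v_c` continuous on `ℝ × O`, nondecreasing in `c`,
nonincreasing in `d`, bounded by `-qp ≤ w ≤ qm`), the investment region
`A⁺ = {(c,d) | d ∈ O, w c d = -qp}` and the disinvestment region
`A⁻ = {(c,d) | d ∈ O, w c d = qm}` are closed in `ℝ × O` (i.e. each is the intersection of a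
closed subset of `ℝ × ℝ` with `ℝ × O`) and, if nonempty, path-connected; the continuation
region `C = {(c,d) | d ∈ O, -qp < w c d < qm}` is open. -/
theorem stmt4
    (O : Set ℝ) (hO : IsOpen O) (hOc : O.OrdConnected)
    (qp qm : ℝ) (hqp : 0 < qp) (hqm : 0 < qm)
    (w : ℝ → ℝ → ℝ)
    (hwcont : ContinuousOn (fun p : ℝ × ℝ => w p.1 p.2) (Set.univ ×ˢ O))
    (hwmono : ∀ d ∈ O, Monotone (fun c => w c d))
    (hwanti : ∀ c : ℝ, AntitoneOn (fun d => w c d) O)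
    (hwbdd : ∀ c : ℝ, ∀ d ∈ O, -qp ≤ w c d ∧ w c d ≤ qm) :
    (∃ F : Set (ℝ × ℝ), IsClosed F ∧
      {p : ℝ × ℝ | p.2 ∈ O ∧ w p.1 p.2 = -qp} = F ∩ (Set.univ ×ˢ O)) ∧
    ({p : ℝ × ℝ | p.2 ∈ O ∧ w p.1 p.2 = -qp}.Nonempty →
      IsPathConnected {p : ℝ × ℝ | p.2 ∈ O ∧ w p.1 p.2 = -qp}) ∧
    (∃ F : Set (ℝ × ℝ), IsClosed F ∧
      {p : ℝ × ℝ | p.2 ∈ O ∧ w p.1 p.2 = qm} = F ∩ (Set.univ ×ˢ O)) ∧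
    ({p : ℝ × ℝ | p.2 ∈ O ∧ w p.1 p.2 = qm}.Nonempty →
      IsPathConnected {p : ℝ × ℝ | p.2 ∈ O ∧ w p.1 p.2 = qm}) ∧
    IsOpen {p : ℝ × ℝ | p.2 ∈ O ∧ -qp < w p.1 p.2 ∧ w p.1 p.2 < qm} := by
  have hcl : ∀ r : ℝ, ∃ F : Set (ℝ × ℝ), IsClosed F ∧
      {p : ℝ × ℝ | p.2 ∈ O ∧ w p.1 p.2 = r} = F ∩ (Set.univ ×ˢ O) := by
    intro r
    obtain ⟨F, hF, e⟩ := continuousOn_iff_isClosed.1 hwcont {r} isClosed_singleton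
    refine ⟨F, hF, ?_⟩
    rw [← e]
    ext p
    simp [and_comm]
  refine ⟨hcl _, ?_, hcl _, ?_, ?_⟩
  · refine aux_down O hOc _ (fun p hp => hp.1) ?_
    rintro ⟨c, d⟩ ⟨hd, hw⟩ a b ha hb hbO
    refine ⟨hbO, le_antisymm ?_ (hwbdd a b hbO).1⟩
    exact ((hwmono b hbO ha).trans (hwanti c hd hbO hb)).trans hw.le
  · refine aux_up O hOc _ (fun p hp => hp.1) ?_
    rintro ⟨c, d⟩ ⟨hd, hw⟩ a b ha hb hbO
    refine ⟨hbO, le_antisymm (hwbdd a b hbO).2 ?_⟩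
    exact hw.ge.trans ((hwanti c hbO hd hb).trans (hwmono b hbO ha))
  · have := hwcont.isOpen_inter_preimage (isOpen_univ.prod hO) (isOpen_Ioo (a := -qp) (b := qm))
    convert this using 1
    ext p
    simp
end

section
/- Let ρ > 0, let ι be a nonempty index type, let a, b : ι → ℝ, and let f : ℝ → ℝ be such that for every c ∈ ℝ the set {c²/(2ρ) + a(i)·c + b(i) | i ∈ ι} is bounded below and f(c) = ⨅_{i ∈ ι} (c²/(2ρ) + a(i)·c + b(i)). Then for every c ∈ ℝ and every ε > 0: f(c+ε) + f(c−ε) − 2·f(c) ≤ ε²/ρ. -/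
/-- Lemma 5.1 of Federico–Pham, analytic core.
Let `ρ > 0`, `ι` a nonempty index type, `a b : ι → ℝ`, and let `f : ℝ → ℝ` be the pointwise
infimum of the quadratics `c ↦ c²/(2ρ) + a i * c + b i` (each such family being bounded
below pointwise). Then the symmetric second differences of `f` satisfy
`f (c+ε) + f (c-ε) - 2 * f c ≤ ε² / ρ` for every `c ∈ ℝ` and `ε > 0`. -/
theorem stmt6
    (ρ : ℝ) (hρ : 0 < ρ)
    (ι : Type*) [Nonempty ι] (a b : ι → ℝ) (f : ℝ → ℝ)
    (hbdd : ∀ c : ℝ, BddBelow (Set.range fun i : ι => c ^ 2 / (2 * ρ) + a i * c + b i))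
    (hf : ∀ c : ℝ, f c = ⨅ i : ι, (c ^ 2 / (2 * ρ) + a i * c + b i)) :
    ∀ c : ℝ, ∀ ε : ℝ, 0 < ε → f (c + ε) + f (c - ε) - 2 * f c ≤ ε ^ 2 / ρ := by
  intro c ε _
  have key : (f (c + ε) + f (c - ε) - ε ^ 2 / ρ) / 2 ≤ f c := by
    rw [hf c]
    refine le_ciInf fun i => ?_
    have h1 : f (c + ε) ≤ (c + ε) ^ 2 / (2 * ρ) + a i * (c + ε) + b i := by
      rw [hf (c + ε)]
      exact ciInf_le (hbdd (c + ε)) i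
    have h2 : f (c - ε) ≤ (c - ε) ^ 2 / (2 * ρ) + a i * (c - ε) + b i := by
      rw [hf (c - ε)]
      exact ciInf_le (hbdd (c - ε)) i
    have h3 : (c + ε) ^ 2 / (2 * ρ) + (c - ε) ^ 2 / (2 * ρ)
        = 2 * (c ^ 2 / (2 * ρ)) + ε ^ 2 / ρ := by
      field_simp
      ring
    linarith
  linarith
end

section
/- Let f : ℝ → ℝ be convex and differentiable, let K ≥ 0, and suppose that f(c+ε) + f(c−ε) − 2·f(c) ≤ K·ε² for all c ∈ ℝ and all ε > 0. Then for all x ≤ y one has 0 ≤ deriv f y − deriv f x ≤ 2·K·(y − x); in particular deriv f is Lipschitz continuous with Lipschitz constant 2K. -/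
/-- Corollary 5.1 of Federico–Pham, analytic core.
If `f : ℝ → ℝ` is convex and differentiable, `K ≥ 0`, and the symmetric second differences
satisfy `f (c+ε) + f (c-ε) - 2 * f c ≤ K * ε²` for all `c` and all `ε > 0`, then for all
`x ≤ y` one has `0 ≤ f'(y) - f'(x) ≤ 2K(y - x)`; in particular `f'` is Lipschitz with
constant `2K`. -/
theorem stmt7
    (f : ℝ → ℝ) (hconv : ConvexOn ℝ Set.univ f) (hdiff : Differentiable ℝ f)
    (K : ℝ) (hK : 0 ≤ K)
    (hsd : ∀ c : ℝ, ∀ ε : ℝ, 0 < ε → f (c + ε) + f (c - ε) - 2 * f c ≤ K * ε ^ 2) :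
    (∀ x y : ℝ, x ≤ y →
      0 ≤ deriv f y - deriv f x ∧ deriv f y - deriv f x ≤ 2 * K * (y - x)) ∧
    (∀ x y : ℝ, |deriv f y - deriv f x| ≤ 2 * K * |y - x|) := by
  have main : ∀ x y : ℝ, x ≤ y →
      0 ≤ deriv f y - deriv f x ∧ deriv f y - deriv f x ≤ 2 * K * (y - x) := by
    intro x y hxy
    refine ⟨sub_nonneg.2 (hconv.monotoneOn_deriv (fun z _ => hdiff z)
      (Set.mem_univ x) (Set.mem_univ y) hxy), ?_⟩
    rcases hxy.eq_or_lt with rfl | hlt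
    · simp
    have hd : 0 < y - x := sub_pos.2 hlt
    have h1 := hconv.deriv_le_slope (Set.mem_univ y) (Set.mem_univ (y + (y - x)))
      (by linarith) (hdiff y)
    have h2 := hconv.slope_le_deriv (Set.mem_univ (x - (y - x))) (Set.mem_univ x)
      (by linarith) (hdiff x)
    rw [slope_def_field, add_sub_cancel_left, le_div_iff₀ hd] at h1
    rw [slope_def_field, sub_sub_cancel, div_le_iff₀ hd] at h2
    have h3 := hsd y (y - x) hd
    have h4 := hsd x (y - x) hd
    rw [sub_sub_cancel] at h3
    rw [add_sub_cancel] at h4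
    refine le_of_mul_le_mul_right ?_ hd
    linarith
  refine ⟨main, fun x y => ?_⟩
  rcases le_total x y with h | h
  · obtain ⟨h1, h2⟩ := main x y h
    rwa [abs_of_nonneg h1, abs_of_nonneg (sub_nonneg.2 h)]
  · obtain ⟨h1, h2⟩ := main y x h
    rwa [abs_sub_comm, abs_sub_comm y x, abs_of_nonneg h1, abs_of_nonneg (sub_nonneg.2 h)]
end

section
/- Let O ⊆ ℝ be open, and let v : ℝ × O → ℝ be such that for every d ∈ O the map c ↦ v(c,d) is differentiable on ℝ and the partial derivative v_c : ℝ × O → ℝ is continuous. Fix (c₀,d₀) ∈ ℝ × O and p, q ∈ ℝ such that limsup_{d → d₀, d ≠ d₀} [v(c₀,d) − v(c₀,d₀) − p·(d−d₀) − q·(d−d₀)²]/(d−d₀)² ≤ 0. Then limsup_{(c,d) → (c₀,d₀), (c,d) ≠ (c₀,d₀)} [v(c,d) − v(c₀,d₀) − v_c(c₀,d₀)·(c−c₀) − p·(d−d₀) − q·(d−d₀)²]/(|c−c₀| + (d−d₀)²) ≤ 0. -/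
open Filter

/-- claims (4.5)–(4.6) in the proof of Lemma 4.1 of Federico–Pham.
Let `O ⊆ ℝ` be open and `v : ℝ × O → ℝ` be differentiable in `c` for each `d ∈ O`, with
continuous partial derivative `v_c` on `ℝ × O`. Fix `(c₀, d₀) ∈ ℝ × O` and `p, q ∈ ℝ` such
that `(p, q)` is a second-order superdifferential of `v(c₀, ·)` at `d₀`, in the sense that
`limsup_{d → d₀, d ≠ d₀} (v(c₀,d) - v(c₀,d₀) - p(d-d₀) - q(d-d₀)²)/(d-d₀)² ≤ 0`.
Then `(v_c(c₀,d₀), p, q)` belongs to the parabolic superdifferential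
`D^{1,2,+}_{c,d} v(c₀,d₀)`:
`limsup_{(c,d) → (c₀,d₀), (c,d) ≠ (c₀,d₀)}
 (v(c,d) - v(c₀,d₀) - v_c(c₀,d₀)(c-c₀) - p(d-d₀) - q(d-d₀)²)/(|c-c₀| + (d-d₀)²) ≤ 0`
(all limsups taken in the extended reals along the punctured neighborhood filter). -/
theorem stmt8
    (O : Set ℝ) (hO : IsOpen O)
    (v : ℝ → ℝ → ℝ)
    (hdiff : ∀ d ∈ O, Differentiable ℝ (fun c : ℝ => v c d))
    (hvc_cont : ContinuousOn (fun p : ℝ × ℝ => deriv (fun c : ℝ => v c p.2) p.1)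
      (Set.univ ×ˢ O))
    (c₀ d₀ : ℝ) (hd₀ : d₀ ∈ O) (p q : ℝ)
    (hsuper : Filter.limsup
      (fun d : ℝ =>
        (((v c₀ d - v c₀ d₀ - p * (d - d₀) - q * (d - d₀) ^ 2) / (d - d₀) ^ 2 : ℝ) : EReal))
      (nhdsWithin d₀ {d₀}ᶜ) ≤ (0 : EReal)) :
    Filter.limsup
      (fun x : ℝ × ℝ =>
        (((v x.1 x.2 - v c₀ d₀ - deriv (fun c : ℝ => v c d₀) c₀ * (x.1 - c₀)
            - p * (x.2 - d₀) - q * (x.2 - d₀) ^ 2)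
          / (|x.1 - c₀| + (x.2 - d₀) ^ 2) : ℝ) : EReal))
      (nhdsWithin (c₀, d₀) {(c₀, d₀)}ᶜ) ≤ (0 : EReal) := by
  rw [← EReal.le_of_forall_lt_iff_le]
  intro ε hε
  have hε0 : (0 : ℝ) < ε := by exact_mod_cast hε
  -- the one-dimensional bound in `d`
  have h1 : ∀ᶠ d in nhdsWithin d₀ {d₀}ᶜ,
      (((v c₀ d - v c₀ d₀ - p * (d - d₀) - q * (d - d₀) ^ 2) / (d - d₀) ^ 2 : ℝ) : EReal)
        < (ε : EReal) :=
    Filter.eventually_lt_of_limsup_lt (lt_of_le_of_lt hsuper hε)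
  rw [eventually_nhdsWithin_iff] at h1
  have h1' : ∀ᶠ d in nhds d₀,
      v c₀ d - v c₀ d₀ - p * (d - d₀) - q * (d - d₀) ^ 2 ≤ ε * (d - d₀) ^ 2 := by
    filter_upwards [h1] with d hd
    by_cases h : d = d₀
    · subst h; simp
    · have h2 := hd h
      have h3 : (0 : ℝ) < (d - d₀) ^ 2 := by
        have : d - d₀ ≠ 0 := sub_ne_zero.2 h
        positivity
      rw [EReal.coe_lt_coe_iff, div_lt_iff₀ h3] at h2
      exact h2.le
  have hcont : ContinuousAt (fun p : ℝ × ℝ => deriv (fun c : ℝ => v c p.2) p.1) (c₀, d₀) :=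
    hvc_cont.continuousAt ((isOpen_univ.prod hO).mem_nhds ⟨Set.mem_univ _, hd₀⟩)
  obtain ⟨δ₁, hδ₁, H1⟩ := Metric.eventually_nhds_iff.1 (h1'.and (hO.mem_nhds hd₀))
  obtain ⟨δ₂, hδ₂, H2⟩ := Metric.continuousAt_iff.1 hcont ε hε0
  apply Filter.limsup_le_of_le
  · isBoundedDefault
  have hball : ∀ᶠ x in nhdsWithin (c₀, d₀) {(c₀, d₀)}ᶜ, x ∈ Metric.ball (c₀, d₀) (min δ₁ δ₂) :=
    mem_nhdsWithin_of_mem_nhds (Metric.ball_mem_nhds _ (lt_min hδ₁ hδ₂))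
  filter_upwards [hball] with x hx
  obtain ⟨c, d⟩ := x
  rw [Metric.mem_ball, Prod.dist_eq, max_lt_iff, lt_min_iff, lt_min_iff] at hx
  obtain ⟨⟨-, hc⟩, hd1, hd2⟩ := hx
  simp only at hc hd1 hd2
  obtain ⟨hA, hdO⟩ := H1 hd1
  set A := deriv (fun c : ℝ => v c d₀) c₀ with hAdef
  have key : ‖(v c d - A * c) - (v c₀ d - A * c₀)‖ ≤ ε * ‖c - c₀‖ := by
    refine Convex.norm_image_sub_le_of_norm_hasDerivWithin_le
      (f := fun c => v c d - A * c)
      (f' := fun c => deriv (fun c : ℝ => v c d) c - A) (s := Metric.ball c₀ δ₂)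
      ?_ ?_ (convex_ball _ _) (Metric.mem_ball_self hδ₂) (Metric.mem_ball.2 hc)
    · intro y _
      have ha := ((hdiff d hdO) y).hasDerivAt
      have hb := (hasDerivAt_id y).const_mul A
      rw [mul_one] at hb
      exact (ha.sub hb).hasDerivWithinAt
    · intro y hy
      have := H2 (x := (y, d)) (by
        rw [Prod.dist_eq]; exact max_lt (Metric.mem_ball.1 hy) hd2)
      rw [dist_eq_norm] at this
      exact this.le
  rw [Real.norm_eq_abs, Real.norm_eq_abs] at key
  have key2 := (abs_le.1 key).2
  rw [EReal.coe_le_coe_iff]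
  refine div_le_of_le_mul₀ (by positivity) hε0.le ?_
  simp only
  linarith
end

section
/- Let d₋ < d₊ be reals, and let ψ, φ : ℝ → ℝ be differentiable on an open set containing [d₋,d₊] and h, m' : ℝ → ℝ continuous on [d₋,d₊]. Let w > 0, S'₋ > 0, S'₊ > 0 be reals with ψ'(d₋)·φ(d₋) − ψ(d₋)·φ'(d₋) = w·S'₋ and ψ'(d₊)·φ(d₊) − ψ(d₊)·φ'(d₊) = w·S'₊. Set P := ∫_{d₋}^{d₊} ψ(ξ)h(ξ)m'(ξ) dξ and Q := ∫_{d₋}^{d₊} φ(ξ)h(ξ)m'(ξ) dξ, and let q⁺ > 0, q⁻ > 0. Suppose A', B' ∈ ℝ satisfy the four equations: A'ψ(d₊) + B'φ(d₊) + w⁻¹φ(d₊)·P = −q⁺; A'ψ(d₋) + B'φ(d₋) + w⁻¹ψ(d₋)·Q = q⁻; A'ψ'(d₊) + B'φ'(d₊) + w⁻¹φ'(d₊)·P = 0; A'ψ'(d₋) + B'φ'(d₋) + w⁻¹ψ'(d₋)·Q = 0. Then P + q⁻·ψ'(d₋)/S'₋ + q⁺·ψ'(d₊)/S'₊ = 0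 and Q + q⁻·φ'(d₋)/S'₋ + q⁺·φ'(d₊)/S'₊ = 0. -/
/-- Proposition 5.2 of Federico–Pham.
Let `d₋ < d₊`, let `ψ, φ` be differentiable on an open set containing `[d₋, d₊]`, and let
`h, m'` be continuous on `[d₋, d₊]`. Let `w > 0`, `S'₋ > 0`, `S'₊ > 0` with
`ψ'(d₋)φ(d₋) - ψ(d₋)φ'(d₋) = w S'₋` and `ψ'(d₊)φ(d₊) - ψ(d₊)φ'(d₊) = w S'₊` (Wronskian
identities), and set `P = ∫_{d₋}^{d₊} ψ h m'` and `Q = ∫_{d₋}^{d₊} φ h m'`. If `A', B'`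
satisfy the four smooth-fit equations at the two boundary points, then
`P + q⁻ ψ'(d₋)/S'₋ + q⁺ ψ'(d₊)/S'₊ = 0` and `Q + q⁻ φ'(d₋)/S'₋ + q⁺ φ'(d₊)/S'₊ = 0`. -/
theorem stmt10
    (dm dp : ℝ) (hdmdp : dm < dp)
    (ψ φ h m' : ℝ → ℝ)
    (hψφ : ∃ U : Set ℝ, IsOpen U ∧ Set.Icc dm dp ⊆ U ∧
      DifferentiableOn ℝ ψ U ∧ DifferentiableOn ℝ φ U)
    (hh : ContinuousOn h (Set.Icc dm dp)) (hm' : ContinuousOn m' (Set.Icc dm dp))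
    (w Sm Sp : ℝ) (hw : 0 < w) (hSm : 0 < Sm) (hSp : 0 < Sp)
    (hWrm : deriv ψ dm * φ dm - ψ dm * deriv φ dm = w * Sm)
    (hWrp : deriv ψ dp * φ dp - ψ dp * deriv φ dp = w * Sp)
    (P Q : ℝ)
    (hP : P = ∫ ξ in dm..dp, ψ ξ * h ξ * m' ξ)
    (hQ : Q = ∫ ξ in dm..dp, φ ξ * h ξ * m' ξ)
    (qp qm : ℝ) (hqp : 0 < qp) (hqm : 0 < qm)
    (A' B' : ℝ)
    (h1 : A' * ψ dp + B' * φ dp + w⁻¹ * φ dp * P = -qp)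
    (h2 : A' * ψ dm + B' * φ dm + w⁻¹ * ψ dm * Q = qm)
    (h3 : A' * deriv ψ dp + B' * deriv φ dp + w⁻¹ * deriv φ dp * P = 0)
    (h4 : A' * deriv ψ dm + B' * deriv φ dm + w⁻¹ * deriv ψ dm * Q = 0) :
    P + qm * deriv ψ dm / Sm + qp * deriv ψ dp / Sp = 0 ∧
    Q + qm * deriv φ dm / Sm + qp * deriv φ dp / Sp = 0 := by
  have hw0 : w ≠ 0 := hw.ne'
  have hm0 : Sm ≠ 0 := hSm.ne'
  have hp0 : Sp ≠ 0 := hSp.ne'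
  have hwi : w * w⁻¹ = 1 := mul_inv_cancel₀ hw0
  generalize w⁻¹ = v at *
  have e1 : qp * deriv ψ dp / Sp = -(w * B' + P) := by
    rw [div_eq_iff hp0]
    linear_combination deriv ψ dp * h1 - ψ dp * h3 - (B' + v * P) * hWrp + (-(Sp * P)) * hwi
  have e2 : qp * deriv φ dp / Sp = w * A' := by
    rw [div_eq_iff hp0]
    linear_combination deriv φ dp * h1 - φ dp * h3 + A' * hWrp
  have e3 : qm * deriv ψ dm / Sm = w * B' := by
    rw [div_eq_iff hm0]
    linear_combination (-deriv ψ dm) * h2 + ψ dm * h4 + B' * hWrm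
  have e4 : qm * deriv φ dm / Sm = -(w * A' + Q) := by
    rw [div_eq_iff hm0]
    linear_combination (-deriv φ dm) * h2 + φ dm * h4 - (A' + v * Q) * hWrm - Sm * Q * hwi
  rw [e1, e2, e3, e4]
  constructor <;> ring
end

section
/- There exists a pair (x,y) ∈ O × O with x < y, L₁(x,y) = 0 and L₂(x,y) = 0 if and only if both sets {ξ ∈ O | h(ξ) < −ρq⁺} and {ξ ∈ O | h(ξ) > ρq⁻} are nonempty. Moreover, when such a pair exists it is unique, and it satisfies h(x) > ρq⁻ and h(y) < −ρq⁺. -/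
open MeasureTheory

/-- The function `L₁` of Proposition 5.3 of Federico–Pham:
`L₁(x,y) = ∫_x^y ψ h m' + q⁻ ψ'(x)/S'(x) + q⁺ ψ'(y)/S'(y)`. -/
noncomputable def FPL1 (ψ S' m' h : ℝ → ℝ) (qm qp : ℝ) (x y : ℝ) : ℝ :=
  (∫ ξ in x..y, ψ ξ * h ξ * m' ξ) + qm * deriv ψ x / S' x + qp * deriv ψ y / S' y

/-- The function `L₂` of Proposition 5.3 of Federico–Pham:
`L₂(x,y) = ∫_x^y φ h m' + q⁻ φ'(x)/S'(x) + q⁺ φ'(y)/S'(y)`. -/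
noncomputable def FPL2 (φ S' m' h : ℝ → ℝ) (qm qp : ℝ) (x y : ℝ) : ℝ :=
  (∫ ξ in x..y, φ ξ * h ξ * m' ξ) + qm * deriv φ x / S' x + qp * deriv φ y / S' y


lemma FP_intOn (O : Set ℝ) (hO : IsOpen O) (f : ℝ → ℝ)
    {ι : Type*} [Countable ι] (T : ι → Set ℝ) (hdir : Directed (· ⊆ ·) T)
    (hT : ⋃ i, T i = O) (hTm : ∀ i, MeasurableSet (T i)) (hf : ContinuousOn f O)
    (hpos : ∀ d ∈ O, 0 < f d)
    (hint : ∀ i, IntegrableOn f (T i)) (K : ℝ) (hK : ∀ i, ∫ ξ in T i, f ξ ≤ K) :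
    IntegrableOn f O := by
  have hsm : AEStronglyMeasurable f (volume.restrict O) :=
    hf.aestronglyMeasurable hO.measurableSet
  refine ⟨hsm, ?_⟩
  have hnn : 0 ≤ᵐ[volume.restrict O] f :=
    (ae_restrict_iff' hO.measurableSet).2 (Filter.Eventually.of_forall fun x hx => (hpos x hx).le)
  rw [hasFiniteIntegral_iff_ofReal hnn]
  have key : ∫⁻ x in O, ENNReal.ofReal (f x) = ⨆ i, ∫⁻ x in T i, ENNReal.ofReal (f x) := by
    conv_lhs => rw [← hT]
    exact setLIntegral_iUnion_of_directed _ hdir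
  rw [key]
  refine lt_of_le_of_lt (iSup_le fun i => ?_) (ENNReal.ofReal_lt_top (r := K))
  have hsub : T i ⊆ O := hT ▸ Set.subset_iUnion T i
  rw [← ofReal_integral_eq_lintegral_ofReal (hint i)]
  · exact ENNReal.ofReal_le_ofReal (hK i)
  · exact (ae_restrict_iff' (hTm i)).2
      (Filter.Eventually.of_forall fun x hx => (hpos x (hsub hx)).le)

lemma FP_unb_right (O : Set ℝ) (hO : IsOpen O) (f : ℝ → ℝ)
    (hf : ContinuousOn f O) (hpos : ∀ d ∈ O, 0 < f d)
    (hint : ∀ d ∈ O, IntegrableOn f (O ∩ Set.Iio d)) (hn : ¬ IntegrableOn f O) (K : ℝ) :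
    ∃ d ∈ O, K < ∫ ξ in O ∩ Set.Iio d, f ξ := by
  by_contra! hcon
  apply hn
  refine FP_intOn O hO f (fun q : {q : ℚ // (q : ℝ) ∈ O} => O ∩ Set.Iio ((q : ℚ) : ℝ)) ?_ ?_ ?_ hf
    hpos (fun q => hint _ q.2) K (fun q => hcon _ q.2)
  · intro p q
    rcases le_total (p : ℚ) (q : ℚ) with hpq | hpq
    · exact ⟨q, fun x hx => ⟨hx.1, lt_of_lt_of_le (b := ((p : ℚ) : ℝ)) hx.2 (by exact_mod_cast hpq)⟩, fun x hx => hx⟩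
    · exact ⟨p, fun x hx => hx, fun x hx => ⟨hx.1, lt_of_lt_of_le (b := ((q : ℚ) : ℝ)) hx.2 (by exact_mod_cast hpq)⟩⟩
  · ext x
    simp only [Set.mem_iUnion]
    constructor
    · rintro ⟨q, hq⟩
      exact hq.1
    · intro hx
      obtain ⟨ε, hε, hball⟩ := Metric.isOpen_iff.1 hO x hx
      obtain ⟨q, hq1, hq2⟩ := exists_rat_btwn (show x < x + ε by linarith)
      refine ⟨⟨q, hball ?_⟩, hx, hq1⟩
      rw [Metric.mem_ball, Real.dist_eq, abs_lt]
      constructor <;> linarith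
  · exact fun q => hO.measurableSet.inter measurableSet_Iio

lemma FP_unb_left (O : Set ℝ) (hO : IsOpen O) (f : ℝ → ℝ)
    (hf : ContinuousOn f O) (hpos : ∀ d ∈ O, 0 < f d)
    (hint : ∀ d ∈ O, IntegrableOn f (O ∩ Set.Ioi d)) (hn : ¬ IntegrableOn f O) (K : ℝ) :
    ∃ d ∈ O, K < ∫ ξ in O ∩ Set.Ioi d, f ξ := by
  by_contra! hcon
  apply hn
  refine FP_intOn O hO f (fun q : {q : ℚ // (q : ℝ) ∈ O} => O ∩ Set.Ioi ((q : ℚ) : ℝ)) ?_ ?_ ?_ hf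
    hpos (fun q => hint _ q.2) K (fun q => hcon _ q.2)
  · intro p q
    rcases le_total (p : ℚ) (q : ℚ) with hpq | hpq
    · exact ⟨p, fun x hx => hx,
        fun x hx => ⟨hx.1, lt_of_le_of_lt (b := ((q : ℚ) : ℝ)) (by exact_mod_cast hpq) hx.2⟩⟩
    · exact ⟨q, fun x hx => ⟨hx.1, lt_of_le_of_lt (b := ((p : ℚ) : ℝ)) (by exact_mod_cast hpq) hx.2⟩,
        fun x hx => hx⟩
  · ext x
    simp only [Set.mem_iUnion]
    constructor
    · rintro ⟨q, hq⟩
      exact hq.1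
    · intro hx
      obtain ⟨ε, hε, hball⟩ := Metric.isOpen_iff.1 hO x hx
      obtain ⟨q, hq1, hq2⟩ := exists_rat_btwn (show x - ε < x by linarith)
      refine ⟨⟨q, hball ?_⟩, hx, hq2⟩
      rw [Metric.mem_ball, Real.dist_eq, abs_lt]
      constructor <;> linarith
  · exact fun q => hO.measurableSet.inter measurableSet_Ioi

lemma FP_split_left (O : Set ℝ) (hO : IsOpen O) (hOc : O.OrdConnected) (f : ℝ → ℝ)
    (hint : ∀ d ∈ O, IntegrableOn f (O ∩ Set.Iio d)) (c d : ℝ) (hc : c ∈ O) (hd : d ∈ O)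
    (hcd : c ≤ d) :
    ∫ ξ in O ∩ Set.Iio d, f ξ = (∫ ξ in O ∩ Set.Iio c, f ξ) + ∫ ξ in c..d, f ξ := by
  have hIco : Set.Ico c d ⊆ O := fun x hx => hOc.out hc hd ⟨hx.1, hx.2.le⟩
  have hU : O ∩ Set.Iio d = (O ∩ Set.Iio c) ∪ Set.Ico c d := by
    ext x
    constructor
    · rintro ⟨h1, h2⟩
      rcases lt_or_ge x c with h3 | h3
      · exact Or.inl ⟨h1, h3⟩
      · exact Or.inr ⟨h3, h2⟩
    · rintro (⟨h1, h2⟩ | h1)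
      · exact ⟨h1, lt_of_lt_of_le h2 hcd⟩
      · exact ⟨hIco h1, h1.2⟩
  have hdisj : Disjoint (O ∩ Set.Iio c) (Set.Ico c d) := by
    rw [Set.disjoint_left]
    rintro x ⟨_, h2⟩ h3
    exact absurd h3.1 (not_le.2 h2)
  rw [hU, setIntegral_union hdisj measurableSet_Ico (hint c hc)
    ((hint d hd).mono_set (fun x hx => ⟨hIco hx, hx.2⟩)),
    intervalIntegral.integral_of_le hcd, integral_Ico_eq_integral_Ioo,
    integral_Ioc_eq_integral_Ioo]

lemma FP_split_right (O : Set ℝ) (hO : IsOpen O) (hOc : O.OrdConnected) (f : ℝ → ℝ)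
    (hint : ∀ d ∈ O, IntegrableOn f (O ∩ Set.Ioi d)) (c d : ℝ) (hc : c ∈ O) (hd : d ∈ O)
    (hcd : c ≤ d) :
    ∫ ξ in O ∩ Set.Ioi c, f ξ = (∫ ξ in O ∩ Set.Ioi d, f ξ) + ∫ ξ in c..d, f ξ := by
  have hIoc : Set.Ioc c d ⊆ O := fun x hx => hOc.out hc hd ⟨hx.1.le, hx.2⟩
  have hU : O ∩ Set.Ioi c = (O ∩ Set.Ioi d) ∪ Set.Ioc c d := by
    ext x
    constructor
    · rintro ⟨h1, h2⟩
      rcases lt_or_ge d x with h3 | h3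
      · exact Or.inl ⟨h1, h3⟩
      · exact Or.inr ⟨h2, h3⟩
    · rintro (⟨h1, h2⟩ | h1)
      · exact ⟨h1, lt_of_le_of_lt hcd h2⟩
      · exact ⟨hIoc h1, h1.1⟩
  have hdisj : Disjoint (O ∩ Set.Ioi d) (Set.Ioc c d) := by
    rw [Set.disjoint_left]
    rintro x ⟨_, h2⟩ h3
    exact absurd h3.2 (not_le.2 h2)
  rw [hU, setIntegral_union hdisj measurableSet_Ioc (hint d hd)
    ((hint c hc).mono_set (fun x hx => ⟨hIoc hx, hx.1⟩)),
    intervalIntegral.integral_of_le hcd]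

lemma FP_ftc (O : Set ℝ) (hO : IsOpen O) (hOc : O.OrdConnected) (f : ℝ → ℝ)
    (hf : ContinuousOn f O) (c d : ℝ) (hc : c ∈ O) (hd : d ∈ O) :
    HasDerivAt (fun u => ∫ ξ in c..u, f ξ) (f d) d := by
  refine intervalIntegral.integral_hasDerivAt_right ?_ ?_ (hf.continuousAt (hO.mem_nhds hd))
  · exact (hf.mono (hOc.uIcc_subset hc hd)).intervalIntegrable
  · exact hf.stronglyMeasurableAtFilter hO d hd

lemma FP_deriv_left (O : Set ℝ) (hO : IsOpen O) (hOc : O.OrdConnected) (f : ℝ → ℝ)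
    (hf : ContinuousOn f O)
    (hint : ∀ d ∈ O, IntegrableOn f (O ∩ Set.Iio d)) (d : ℝ) (hd : d ∈ O) :
    HasDerivAt (fun u => ∫ ξ in O ∩ Set.Iio u, f ξ) (f d) d := by
  have h1 := (FP_ftc O hO hOc f hf d d hd hd).const_add (∫ ξ in O ∩ Set.Iio d, f ξ)
  refine h1.congr_of_eventuallyEq ?_
  filter_upwards [hO.mem_nhds hd] with u hu
  rcases le_total d u with h | h
  · exact FP_split_left O hO hOc f hint d u hd hu h
  · have := FP_split_left O hO hOc f hint u d hu hd h
    rw [intervalIntegral.integral_symm]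
    linarith

lemma FP_deriv_right (O : Set ℝ) (hO : IsOpen O) (hOc : O.OrdConnected) (f : ℝ → ℝ)
    (hf : ContinuousOn f O)
    (hint : ∀ d ∈ O, IntegrableOn f (O ∩ Set.Ioi d)) (d : ℝ) (hd : d ∈ O) :
    HasDerivAt (fun u => ∫ ξ in O ∩ Set.Ioi u, f ξ) (-f d) d := by
  have h1 := (FP_ftc O hO hOc f hf d d hd hd).const_sub (∫ ξ in O ∩ Set.Ioi d, f ξ)
  refine h1.congr_of_eventuallyEq ?_
  filter_upwards [hO.mem_nhds hd] with u hu
  rcases le_total d u with h | h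
  · have := FP_split_right O hO hOc f hint d u hd hu h
    linarith
  · have := FP_split_right O hO hOc f hint u d hu hd h
    rw [intervalIntegral.integral_symm]
    linarith

/-- strict monotonicity between two points from positivity of the derivative inside -/
lemma FP_lt (F F' : ℝ → ℝ) (x y : ℝ) (hxy : x < y)
    (hF : ∀ t ∈ Set.Icc x y, HasDerivAt F (F' t) t) (hpos : ∀ t ∈ Set.Ioo x y, 0 < F' t) :
    F x < F y := by
  obtain ⟨c, hc, hc'⟩ := exists_hasDerivAt_eq_slope F F' hxy
    (fun t ht => (hF t ht).continuousAt.continuousWithinAt)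
    (fun t ht => hF t ⟨ht.1.le, ht.2.le⟩)
  have h1 := hpos c hc
  rw [hc'] at h1
  have h2 : 0 < y - x := by linarith
  have := (div_pos_iff_of_pos_right h2).1 h1
  linarith

lemma FP_core
    (O : Set ℝ) (hOc : O.OrdConnected) (a b : ℝ) (ha : 0 < a) (hb : 0 < b)
    (ψ φ m h P H R J : ℝ → ℝ)
    (hψpos : ∀ d ∈ O, 0 < ψ d) (hψmono : StrictMonoOn ψ O)
    (hφpos : ∀ d ∈ O, 0 < φ d) (hφanti : StrictAntiOn φ O)
    (hmpos : ∀ d ∈ O, 0 < m d)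
    (hhc : ContinuousOn h O) (hhanti : StrictAntiOn h O)
    (hP : ∀ d ∈ O, HasDerivAt P (ψ d * m d) d)
    (hH : ∀ d ∈ O, HasDerivAt H (ψ d * h d * m d) d)
    (hR : ∀ d ∈ O, HasDerivAt R (-(φ d * m d)) d)
    (hJ : ∀ d ∈ O, HasDerivAt J (-(φ d * h d * m d)) d)
    (hP0 : ∀ d ∈ O, 0 ≤ P d) (hR0 : ∀ d ∈ O, 0 ≤ R d)
    (hPu : ∀ K, ∃ d ∈ O, K < P d) (hRu : ∀ K, ∃ d ∈ O, K < R d)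
    (hD0 : ∀ d ∈ O, h d ≤ -b → J d + b * R d ≤ 0) :
    ((∃ x ∈ O, ∃ y ∈ O, x < y ∧ H y + b * P y = H x - a * P x ∧ J x - a * R x = J y + b * R y) ↔
      ({ξ ∈ O | h ξ < -b}.Nonempty ∧ {ξ ∈ O | a < h ξ}.Nonempty)) ∧
    (∀ x ∈ O, ∀ y ∈ O, x < y →
      H y + b * P y = H x - a * P x → J x - a * R x = J y + b * R y →
      a < h x ∧ h y < -b ∧
      ∀ x' ∈ O, ∀ y' ∈ O, x' < y' →
        H y' + b * P y' = H x' - a * P x' → J x' - a * R x' = J y' + b * R y' →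
        x' = x ∧ y' = y) := by
  have hA : ∀ k, ∀ d ∈ O, HasDerivAt (fun u => H u + k * P u) (ψ d * m d * (h d + k)) d := by
    intro k d hd
    exact ((hH d hd).add ((hP d hd).const_mul k)).congr_deriv (by ring)
  have hC : ∀ k, ∀ d ∈ O, HasDerivAt (fun u => J u + k * R u) (-(φ d * m d * (h d + k))) d := by
    intro k d hd
    exact ((hJ d hd).add ((hR d hd).const_mul k)).congr_deriv (by ring)
  have hψm : ∀ d ∈ O, 0 < ψ d * m d := fun d hd => mul_pos (hψpos d hd) (hmpos d hd)
  have hφm : ∀ d ∈ O, 0 < φ d * m d := fun d hd => mul_pos (hφpos d hd) (hmpos d hd)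
  -- monotonicity
  have Aup : ∀ k, ∀ x ∈ O, ∀ y ∈ O, x < y → -k ≤ h y → H x + k * P x < H y + k * P y := by
    intro k x hx y hy hxy hk
    refine FP_lt (fun u => H u + k * P u) (fun d => ψ d * m d * (h d + k)) x y hxy
      (fun t ht => hA k t (hOc.out hx hy ht)) (fun t ht => ?_)
    have htO := hOc.out hx hy ⟨ht.1.le, ht.2.le⟩
    have := hhanti htO hy ht.2
    exact mul_pos (hψm t htO) (by linarith)
  have Adn : ∀ k, ∀ x ∈ O, ∀ y ∈ O, x < y → h x ≤ -k → H y + k * P y < H x + k * P x := by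
    intro k x hx y hy hxy hk
    have := FP_lt (fun u => -(H u + k * P u)) (fun d => -(ψ d * m d * (h d + k))) x y hxy
      (fun t ht => (hA k t (hOc.out hx hy ht)).neg) (fun t ht => by
        have htO := hOc.out hx hy ⟨ht.1.le, ht.2.le⟩
        have := hhanti hx htO ht.1
        have := mul_pos (hψm t htO) (show 0 < -(h t + k) by linarith)
        linarith)
    linarith
  have Cdn : ∀ k, ∀ x ∈ O, ∀ y ∈ O, x < y → -k ≤ h y → J y + k * R y < J x + k * R x := by
    intro k x hx y hy hxy hk
    have := FP_lt (fun u => -(J u + k * R u)) (fun d => - -(φ d * m d * (h d + k))) x y hxy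
      (fun t ht => (hC k t (hOc.out hx hy ht)).neg) (fun t ht => by
        have htO := hOc.out hx hy ⟨ht.1.le, ht.2.le⟩
        have := hhanti htO hy ht.2
        have := mul_pos (hφm t htO) (show 0 < (h t + k) by linarith)
        linarith)
    linarith
  have Cup : ∀ k, ∀ x ∈ O, ∀ y ∈ O, x < y → h x ≤ -k → J x + k * R x < J y + k * R y := by
    intro k x hx y hy hxy hk
    refine FP_lt (fun u => J u + k * R u) (fun d => -(φ d * m d * (h d + k))) x y hxy
      (fun t ht => hC k t (hOc.out hx hy ht)) (fun t ht => ?_)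
    have htO := hOc.out hx hy ⟨ht.1.le, ht.2.le⟩
    have := hhanti hx htO ht.1
    have := mul_pos (hφm t htO) (show 0 < -(h t + k) by linarith)
    linarith
  -- location
  have loc : ∀ x ∈ O, ∀ y ∈ O, x < y →
      H y + b * P y = H x - a * P x → J x - a * R x = J y + b * R y → a < h x ∧ h y < -b := by
    intro x hx y hy hxy h1 h2
    constructor
    · by_contra! hcon
      have e1 := Cup (-a) x hx y hy hxy (by linarith)
      have e2 := mul_nonneg ha.le (hR0 y hy)
      have e3 := mul_nonneg hb.le (hR0 y hy)
      linarith
    · by_contra! hcon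
      have e1 := Aup b x hx y hy hxy hcon
      have e2 := mul_nonneg ha.le (hP0 x hx)
      have e3 := mul_nonneg hb.le (hP0 x hx)
      linarith
  -- no two ordered solutions
  have noord : ∀ x ∈ O, ∀ y ∈ O, x < y →
      H y + b * P y = H x - a * P x → J x - a * R x = J y + b * R y →
      ∀ x' ∈ O, ∀ y' ∈ O, x' < y' →
        H y' + b * P y' = H x' - a * P x' → J x' - a * R x' = J y' + b * R y' → ¬ x < x' := by
    intro x hx y hy hxy h1 h2 x' hx' y' hy' hxy' h1' h2' hlt
    obtain ⟨l1, l2⟩ := loc x hx y hy hxy h1 h2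
    obtain ⟨l1', l2'⟩ := loc x' hx' y' hy' hxy' h1' h2'
    have eB := Aup (-a) x hx x' hx' hlt (by linarith)
    have hyy : y' < y := by
      by_contra! hcon
      rcases hcon.lt_or_eq with hc | hc
      · have := Adn b y hy y' hy' hc l2.le
        linarith
      · subst hc
        linarith
    obtain ⟨c, hc, ec⟩ := exists_ratio_hasDerivAt_eq_ratio_slope
      (fun u => H u + (-a) * P u) (fun d => ψ d * m d * (h d + (-a))) hlt
      (fun t ht => (hA (-a) t (hOc.out hx hx' ht)).continuousAt.continuousWithinAt)
      (fun t ht => hA (-a) t (hOc.out hx hx' ⟨ht.1.le, ht.2.le⟩))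
      (fun u => J u + (-a) * R u) (fun d => -(φ d * m d * (h d + (-a))))
      (fun t ht => (hC (-a) t (hOc.out hx hx' ht)).continuousAt.continuousWithinAt)
      (fun t ht => hC (-a) t (hOc.out hx hx' ⟨ht.1.le, ht.2.le⟩))
    obtain ⟨d, hd, ed⟩ := exists_ratio_hasDerivAt_eq_ratio_slope
      (fun u => H u + b * P u) (fun d => ψ d * m d * (h d + b)) hyy
      (fun t ht => (hA b t (hOc.out hy' hy ht)).continuousAt.continuousWithinAt)
      (fun t ht => hA b t (hOc.out hy' hy ⟨ht.1.le, ht.2.le⟩))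
      (fun u => J u + b * R u) (fun d => -(φ d * m d * (h d + b)))
      (fun t ht => (hC b t (hOc.out hy' hy ht)).continuousAt.continuousWithinAt)
      (fun t ht => hC b t (hOc.out hy' hy ⟨ht.1.le, ht.2.le⟩))
    have hcO := hOc.out hx hx' ⟨hc.1.le, hc.2.le⟩
    have hdO := hOc.out hy' hy ⟨hd.1.le, hd.2.le⟩
    have hcd : c < d := by linarith [hc.2, hd.1]
    have hhc' := hhanti hcO hx' hc.2
    have hhd' := hhanti hy' hdO hd.1
    obtain ⟨I, hI⟩ : ∃ I, I = H x' + -a * P x' - (H x + -a * P x) := ⟨_, rfl⟩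
    obtain ⟨Q, hQ⟩ : ∃ Q, Q = J x' + -a * R x' - (J x + -a * R x) := ⟨_, rfl⟩
    have hI0 : 0 < I := by linarith
    rw [← hI, ← hQ] at ec
    rw [show H y + b * P y - (H y' + b * P y') = -I by linarith,
      show J y + b * R y - (J y' + b * R y') = -Q by linarith] at ed
    have ec' : Q * ψ c = -(I * φ c) := by
      have : m c * (h c + -a) ≠ 0 := (mul_pos (hmpos c hcO) (by linarith)).ne'
      apply mul_right_cancel₀ this
      linarith
    have ed' : Q * ψ d = -(I * φ d) := by
      have : m d * (h d + b) ≠ 0 :=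
        mul_ne_zero (hmpos d hdO).ne' (by linarith)
      apply mul_right_cancel₀ this
      linarith
    have f1 := hψmono hcO hdO hcd
    have f2 := hφanti hcO hdO hcd
    have f3 := mul_pos hI0 (hφpos c hcO)
    have hQ0 : Q < 0 := by
      by_contra! hq
      have := mul_nonneg hq (hψpos c hcO).le
      linarith
    have f4 := mul_lt_mul_of_neg_left f1 hQ0
    have f5 := mul_lt_mul_of_pos_left f2 hI0
    linarith
  have uniq : ∀ x ∈ O, ∀ y ∈ O, x < y →
      H y + b * P y = H x - a * P x → J x - a * R x = J y + b * R y →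
      ∀ x' ∈ O, ∀ y' ∈ O, x' < y' →
        H y' + b * P y' = H x' - a * P x' → J x' - a * R x' = J y' + b * R y' →
        x' = x ∧ y' = y := by
    intro x hx y hy hxy h1 h2 x' hx' y' hy' hxy' h1' h2'
    have n1 := noord x hx y hy hxy h1 h2 x' hx' y' hy' hxy' h1' h2'
    have n2 := noord x' hx' y' hy' hxy' h1' h2' x hx y hy hxy h1 h2
    have hxx : x' = x := le_antisymm (not_lt.1 n1) (not_lt.1 n2)
    refine ⟨hxx, ?_⟩
    subst hxx
    obtain ⟨-, l2⟩ := loc x' hx y hy hxy h1 h2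
    obtain ⟨-, l2'⟩ := loc x' hx' y' hy' hxy' h1' h2'
    rcases lt_trichotomy y' y with hc | hc | hc
    · have := Adn b y' hy' y hy hc l2'.le
      linarith
    · exact hc
    · have := Adn b y hy y' hy' hc l2.le
      linarith
  refine ⟨⟨?_, ?_⟩, fun x hx y hy hxy h1 h2 =>
    ⟨(loc x hx y hy hxy h1 h2).1, (loc x hx y hy hxy h1 h2).2, uniq x hx y hy hxy h1 h2⟩⟩
  · rintro ⟨x, hx, y, hy, hxy, h1, h2⟩
    obtain ⟨l1, l2⟩ := loc x hx y hy hxy h1 h2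
    exact ⟨⟨y, hy, l2⟩, ⟨x, hx, l1⟩⟩
  -- existence
  rintro ⟨⟨v, hv, hvb⟩, ⟨u, hu, hua⟩⟩
  have huv : u < v := (hhanti.lt_iff_gt hv hu).1 (by linarith)
  have hIcc : Set.Icc u v ⊆ O := hOc.out hu hv
  have ivt := intermediate_value_Icc' huv.le (hhc.mono hIcc)
  obtain ⟨xa, hxaI, hxa⟩ := ivt (show a ∈ Set.Icc (h v) (h u) from ⟨by linarith, hua.le⟩)
  obtain ⟨yb, hybI, hyb⟩ := ivt (show -b ∈ Set.Icc (h v) (h u) from ⟨hvb.le, by linarith⟩)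
  have hxaO := hIcc hxaI
  have hybO := hIcc hybI
  have hab : xa < yb := (hhanti.lt_iff_gt hybO hxaO).1 (by linarith)
  have huxa : u < xa := (hhanti.lt_iff_gt hxaO hu).1 (by linarith)
  have hybv : yb < v := (hhanti.lt_iff_gt hv hybO).1 (by linarith)
  -- x1 with C x1 ≥ 0
  obtain ⟨x1, hx1O, hx1, hCx1⟩ : ∃ x1 ∈ O, x1 < xa ∧ 0 ≤ J x1 - a * R x1 := by
    -- `J - h(u) R` is decreasing to the left of `u`
    have hδ : 0 < h u - a := by linarith
    obtain ⟨w, hw, hwK⟩ := hRu (max (R u) ((-(J u - h u * R u)) / (h u - a)))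
    have hw1 := (le_max_left _ _).trans_lt hwK
    have hw2 := (le_max_right _ _).trans_lt hwK
    have hRanti : ∀ x ∈ O, ∀ y ∈ O, x < y → R y < R x := by
      intro x hx y hy hxy
      have := FP_lt (fun u => -(R u)) (fun d => - -(φ d * m d)) x y hxy
        (fun t ht => (hR t (hOc.out hx hy ht)).neg) (fun t ht => by
          have := hφm t (hOc.out hx hy ⟨ht.1.le, ht.2.le⟩)
          linarith)
      linarith
    have hwu : w < u := by
      by_contra! hcon
      rcases hcon.lt_or_eq with hc | hc
      · have := hRanti u hu w hw hc
        linarith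
      · subst hc
        linarith
    refine ⟨w, hw, hwu.trans huxa, ?_⟩
    have e1 := Cdn (-(h u)) w hw u hu hwu (by linarith)
    rw [div_lt_iff₀ hδ] at hw2
    linarith
  obtain ⟨y1, hy1O, hy1, hAy1⟩ : ∃ y1 ∈ O, yb < y1 ∧ H y1 + b * P y1 ≤ H x1 - a * P x1 := by
    have hδ : 0 < -(h v + b) := by linarith
    obtain ⟨w, hw, hwK⟩ := hPu (max (P v) ((H v - h v * P v - (H x1 - a * P x1)) / (-(h v + b))))
    have hw1 := (le_max_left _ _).trans_lt hwK
    have hw2 := (le_max_right _ _).trans_lt hwK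
    have hPmono : ∀ x ∈ O, ∀ y ∈ O, x < y → P x < P y := by
      intro x hx y hy hxy
      exact FP_lt P (fun d => (ψ d * m d)) x y hxy
        (fun t ht => hP t (hOc.out hx hy ht)) (fun t ht =>
          hψm t (hOc.out hx hy ⟨ht.1.le, ht.2.le⟩))
    have hwv : v < w := by
      by_contra! hcon
      rcases hcon.lt_or_eq with hc | hc
      · have := hPmono w hw v hv hc
        linarith
      · subst hc
        linarith
    refine ⟨w, hw, hybv.trans hwv, ?_⟩
    have e1 := Adn (-(h v)) v hv w hw hwv (by linarith)
    rw [div_lt_iff₀ hδ] at hw2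
    linarith
  have hXO : Set.Icc x1 xa ⊆ O := hOc.out hx1O hxaO
  have hYO : Set.Icc yb y1 ⊆ O := hOc.out hybO hy1O
  have cA : ∀ k, ContinuousOn (fun u => H u + k * P u) O := fun k t ht =>
    (hA k t ht).continuousAt.continuousWithinAt
  have cC : ∀ k, ContinuousOn (fun u => J u + k * R u) O := fun k t ht =>
    (hC k t ht).continuousAt.continuousWithinAt
  -- existence of y for every x
  have exY : ∀ x ∈ Set.Icc x1 xa, ∃ y ∈ Set.Icc yb y1, H y + b * P y = H x + (-a) * P x := by
    intro x hx
    have e1 : H x1 + (-a) * P x1 ≤ H x + (-a) * P x := by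
      rcases hx.1.eq_or_lt with hc | hc
      · rw [hc]
      · exact (Aup (-a) x1 hx1O x (hXO hx) hc (by
          have := hhanti.antitoneOn (hXO hx) hxaO hx.2
          linarith)).le
    have e2 : H x + (-a) * P x ≤ H xa + (-a) * P xa := by
      rcases hx.2.eq_or_lt with hc | hc
      · rw [hc]
      · exact (Aup (-a) x (hXO hx) xa hxaO hc (by linarith)).le
    have e3 := Aup b xa hxaO yb hybO hab (by linarith)
    have e4 := mul_nonneg ha.le (hP0 xa hxaO)
    have e5 := mul_nonneg hb.le (hP0 xa hxaO)
    exact intermediate_value_Icc' hy1.le ((cA b).mono hYO) ⟨by linarith, by linarith⟩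
  have uqY : ∀ y ∈ Set.Icc yb y1, ∀ y' ∈ Set.Icc yb y1, H y + b * P y = H y' + b * P y' →
      y = y' := by
    have aux : ∀ y ∈ Set.Icc yb y1, ∀ y' ∈ Set.Icc yb y1, y < y' →
        H y' + b * P y' < H y + b * P y := by
      intro y hy y' hy' hlt
      refine Adn b y (hYO hy) y' (hYO hy') hlt ?_
      have := hhanti.antitoneOn hybO (hYO hy) hy.1
      linarith
    intro y hy y' hy' he
    rcases lt_trichotomy y y' with hc | hc | hc
    · have := aux y hy y' hy' hc
      linarith
    · exact hc
    · have := aux y' hy' y hy hc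
      linarith
  -- closed projections
  let K : Set (ℝ × ℝ) := Set.Icc x1 xa ×ˢ Set.Icc yb y1
  have hK : IsCompact K := isCompact_Icc.prod isCompact_Icc
  let G1 : ℝ × ℝ → ℝ := fun p => (H p.2 + b * P p.2) - (H p.1 + (-a) * P p.1)
  let G2 : ℝ × ℝ → ℝ := fun p => (J p.1 + (-a) * R p.1) - (J p.2 + b * R p.2)
  have m1 : Set.MapsTo Prod.fst K O := fun p hp => hXO hp.1
  have m2 : Set.MapsTo Prod.snd K O := fun p hp => hYO hp.2
  have cG1 : ContinuousOn G1 K :=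
    ((cA b).comp continuousOn_snd m2).sub ((cA (-a)).comp continuousOn_fst m1)
  have cG2 : ContinuousOn G2 K :=
    ((cC (-a)).comp continuousOn_fst m1).sub ((cC b).comp continuousOn_snd m2)
  have hclosed : ∀ T : Set ℝ, IsClosed T →
      IsClosed (Set.image Prod.fst (K ∩ Set.preimage (fun p => (G1 p, G2 p)) ({0} ×ˢ T))) := by
    intro T hT
    have h1 : IsClosed (K ∩ Set.preimage (fun p => (G1 p, G2 p)) ({0} ×ˢ T)) :=
      (cG1.prodMk cG2).preimage_isClosed_of_isClosed hK.isClosed (isClosed_singleton.prod hT)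
    exact ((hK.of_isClosed_subset h1 Set.inter_subset_left).image continuous_fst).isClosed
  have hpre := isPreconnected_closed_iff.1 (isPreconnected_Icc (a := x1) (b := xa)) _ _
    (hclosed (Set.Ici 0) isClosed_Ici) (hclosed (Set.Iic 0) isClosed_Iic) ?_ ?_ ?_
  · obtain ⟨x, hx, ⟨⟨p1, p2⟩, ⟨hpK, hpG⟩, hpx⟩, ⟨⟨p1', p2'⟩, ⟨hpK', hpG'⟩, hpx'⟩⟩ := hpre
    simp only at hpx hpx'
    subst hpx
    subst hpx'
    have g1 : G1 (p1', p2) = 0 := hpG.1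
    have g1' : G1 (p1', p2') = 0 := hpG'.1
    have g2 : 0 ≤ G2 (p1', p2) := hpG.2
    have g2' : G2 (p1', p2') ≤ 0 := hpG'.2
    have hpp : p2 = p2' := uqY p2 hpK.2 p2' hpK'.2 (by simp only [G1] at g1 g1'; linarith)
    subst hpp
    refine ⟨p1', hXO hx, p2, hYO hpK.2, ?_, ?_, ?_⟩
    · have := hx.2
      have : yb ≤ p2 := hpK.2.1
      linarith
    · simp only [G1] at g1
      linarith
    · simp only [G2] at g2 g2'
      linarith
  · intro x hx
    obtain ⟨y, hy, hxy⟩ := exY x hx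
    have g1 : G1 (x, y) = 0 := by simp only [G1]; linarith
    rcases le_total 0 (G2 (x, y)) with hc | hc
    · exact Or.inl ⟨(x, y), ⟨⟨hx, hy⟩, ⟨g1, hc⟩⟩, rfl⟩
    · exact Or.inr ⟨(x, y), ⟨⟨hx, hy⟩, ⟨g1, hc⟩⟩, rfl⟩
  · have hx : x1 ∈ Set.Icc x1 xa := ⟨le_rfl, hx1.le⟩
    obtain ⟨y, hy, hxy⟩ := exY x1 hx
    have g1 : G1 (x1, y) = 0 := by simp only [G1]; linarith
    refine ⟨x1, hx, ⟨(x1, y), ⟨⟨hx, hy⟩, ⟨g1, ?_⟩⟩, rfl⟩⟩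
    have := hD0 y (hYO hy) (by
      have := hhanti.antitoneOn hybO (hYO hy) hy.1
      linarith)
    simp only [G2, Set.mem_Ici]
    linarith
  · have hx : xa ∈ Set.Icc x1 xa := ⟨hx1.le, le_rfl⟩
    obtain ⟨y, hy, hxy⟩ := exY xa hx
    have g1 : G1 (xa, y) = 0 := by simp only [G1]; linarith
    refine ⟨xa, hx, ⟨(xa, y), ⟨⟨hx, hy⟩, ⟨g1, ?_⟩⟩, rfl⟩⟩
    have e1 := Cup (-a) xa hxaO y (hYO hy) (by have := hy.1; linarith) (by linarith)
    have e2 := mul_nonneg ha.le (hR0 y (hYO hy))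
    have e3 := mul_nonneg hb.le (hR0 y (hYO hy))
    simp only [G2, Set.mem_Iic]
    linarith

/-- existence and uniqueness in Proposition 5.3 of Federico–Pham.
In the setting of the fundamental solutions `ψ` (positive, strictly increasing) and `φ`
(positive, strictly decreasing) of the demand diffusion on the open interval `O`, with
scale density `S'` and speed density `m'`, the resolvent identities
`ψ'/S' = ρ ∫_{O∩(-∞,·)} ψ m'` and `φ'/S' = -ρ ∫_{O∩(·,∞)} φ m'`, non-integrability of
`ψ m'` and `φ m'` on `O`, and `h` continuous and strictly decreasing with the stated
integrability: the system `L₁(x,y) = L₂(x,y) = 0` has a solution with `x < y` in `O × O`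
iff both `{h < -ρq⁺}` and `{h > ρq⁻}` meet `O`; the solution is then unique and satisfies
`h(x) > ρq⁻` and `h(y) < -ρq⁺`. -/
theorem stmt11
    (O : Set ℝ) (hO : IsOpen O) (hOc : O.OrdConnected) (hOne : O.Nonempty)
    (ρ qp qm : ℝ) (hρ : 0 < ρ) (hqp : 0 < qp) (hqm : 0 < qm)
    (ψ φ S' m' h : ℝ → ℝ)
    (hψd : DifferentiableOn ℝ ψ O) (hψpos : ∀ d ∈ O, 0 < ψ d) (hψmono : StrictMonoOn ψ O)
    (hφd : DifferentiableOn ℝ φ O) (hφpos : ∀ d ∈ O, 0 < φ d) (hφanti : StrictAntiOn φ O)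
    (hS'c : ContinuousOn S' O) (hS'pos : ∀ d ∈ O, 0 < S' d)
    (hm'c : ContinuousOn m' O) (hm'pos : ∀ d ∈ O, 0 < m' d)
    (hψint : ∀ d ∈ O, IntegrableOn (fun ξ => ψ ξ * m' ξ) (O ∩ Set.Iio d) ∧
      deriv ψ d / S' d = ρ * ∫ ξ in O ∩ Set.Iio d, ψ ξ * m' ξ)
    (hφint : ∀ d ∈ O, IntegrableOn (fun ξ => φ ξ * m' ξ) (O ∩ Set.Ioi d) ∧
      deriv φ d / S' d = -(ρ * ∫ ξ in O ∩ Set.Ioi d, φ ξ * m' ξ))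
    (hψnonint : ¬ IntegrableOn (fun ξ => ψ ξ * m' ξ) O)
    (hφnonint : ¬ IntegrableOn (fun ξ => φ ξ * m' ξ) O)
    (hhc : ContinuousOn h O) (hhanti : StrictAntiOn h O)
    (hhint : ∀ d ∈ O, IntegrableOn (fun ξ => ψ ξ * h ξ * m' ξ) (O ∩ Set.Iio d) ∧
      IntegrableOn (fun ξ => φ ξ * h ξ * m' ξ) (O ∩ Set.Ioi d)) :
    ((∃ x ∈ O, ∃ y ∈ O, x < y ∧
        FPL1 ψ S' m' h qm qp x y = 0 ∧ FPL2 φ S' m' h qm qp x y = 0) ↔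
      ({ξ ∈ O | h ξ < -(ρ * qp)}.Nonempty ∧ {ξ ∈ O | ρ * qm < h ξ}.Nonempty)) ∧
    (∀ x ∈ O, ∀ y ∈ O, x < y →
      FPL1 ψ S' m' h qm qp x y = 0 → FPL2 φ S' m' h qm qp x y = 0 →
      ρ * qm < h x ∧ h y < -(ρ * qp) ∧
      ∀ x' ∈ O, ∀ y' ∈ O, x' < y' →
        FPL1 ψ S' m' h qm qp x' y' = 0 → FPL2 φ S' m' h qm qp x' y' = 0 →
        x' = x ∧ y' = y) := by
  have cψ := hψd.continuousOn
  have cφ := hφd.continuousOn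
  have cP : ContinuousOn (fun ξ => ψ ξ * m' ξ) O := cψ.mul hm'c
  have cR : ContinuousOn (fun ξ => φ ξ * m' ξ) O := cφ.mul hm'c
  have cH : ContinuousOn (fun ξ => ψ ξ * h ξ * m' ξ) O := (cψ.mul hhc).mul hm'c
  have cJ : ContinuousOn (fun ξ => φ ξ * h ξ * m' ξ) O := (cφ.mul hhc).mul hm'c
  have pP : ∀ d ∈ O, 0 < ψ d * m' d := fun d hd => mul_pos (hψpos d hd) (hm'pos d hd)
  have pR : ∀ d ∈ O, 0 < φ d * m' d := fun d hd => mul_pos (hφpos d hd) (hm'pos d hd)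
  have hmI : ∀ d, MeasurableSet (O ∩ Set.Iio d) := fun d =>
    hO.measurableSet.inter measurableSet_Iio
  have hmJ : ∀ d, MeasurableSet (O ∩ Set.Ioi d) := fun d =>
    hO.measurableSet.inter measurableSet_Ioi
  have core := FP_core O hOc (ρ * qm) (ρ * qp) (mul_pos hρ hqm) (mul_pos hρ hqp) ψ φ m' h
    (fun d => ∫ ξ in O ∩ Set.Iio d, ψ ξ * m' ξ)
    (fun d => ∫ ξ in O ∩ Set.Iio d, ψ ξ * h ξ * m' ξ)
    (fun d => ∫ ξ in O ∩ Set.Ioi d, φ ξ * m' ξ)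
    (fun d => ∫ ξ in O ∩ Set.Ioi d, φ ξ * h ξ * m' ξ)
    hψpos hψmono hφpos hφanti hm'pos hhc hhanti
    (FP_deriv_left O hO hOc _ cP (fun d hd => (hψint d hd).1))
    (FP_deriv_left O hO hOc _ cH (fun d hd => (hhint d hd).1))
    (FP_deriv_right O hO hOc _ cR (fun d hd => (hφint d hd).1))
    (FP_deriv_right O hO hOc _ cJ (fun d hd => (hhint d hd).2))
    (fun d hd => setIntegral_nonneg (hmI d) fun x hx => (pP x hx.1).le)
    (fun d hd => setIntegral_nonneg (hmJ d) fun x hx => (pR x hx.1).le)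
    (FP_unb_right O hO _ cP pP (fun d hd => (hψint d hd).1) hψnonint)
    (FP_unb_left O hO _ cR pR (fun d hd => (hφint d hd).1) hφnonint)
    (by
      intro d hd hle
      rw [← integral_const_mul,
        ← integral_add (hhint d hd).2 ((hφint d hd).1.const_mul (ρ * qp))]
      refine setIntegral_nonpos (hmJ d) fun x hx => ?_
      have h1 := hhanti hd hx.1 hx.2
      have h2 := mul_pos (pR x hx.1) (show 0 < -(h x + ρ * qp) by linarith)
      linarith)
  have e1 : ∀ x ∈ O, ∀ y ∈ O, x < y → (FPL1 ψ S' m' h qm qp x y = 0 ↔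
      (∫ ξ in O ∩ Set.Iio y, ψ ξ * h ξ * m' ξ) + ρ * qp * ∫ ξ in O ∩ Set.Iio y, ψ ξ * m' ξ
      = (∫ ξ in O ∩ Set.Iio x, ψ ξ * h ξ * m' ξ)
        - ρ * qm * ∫ ξ in O ∩ Set.Iio x, ψ ξ * m' ξ) := by
    intro x hx y hy hxy
    have s := FP_split_left O hO hOc _ (fun d hd => (hhint d hd).1) x y hx hy hxy.le
    unfold FPL1
    rw [mul_div_assoc, mul_div_assoc, (hψint x hx).2, (hψint y hy).2]
    constructor <;> intro hh <;> linarith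
  have e2 : ∀ x ∈ O, ∀ y ∈ O, x < y → (FPL2 φ S' m' h qm qp x y = 0 ↔
      (∫ ξ in O ∩ Set.Ioi x, φ ξ * h ξ * m' ξ) - ρ * qm * ∫ ξ in O ∩ Set.Ioi x, φ ξ * m' ξ
      = (∫ ξ in O ∩ Set.Ioi y, φ ξ * h ξ * m' ξ)
        + ρ * qp * ∫ ξ in O ∩ Set.Ioi y, φ ξ * m' ξ) := by
    intro x hx y hy hxy
    have s := FP_split_right O hO hOc _ (fun d hd => (hhint d hd).2) x y hx hy hxy.le
    unfold FPL2
    rw [mul_div_assoc, mul_div_assoc, (hφint x hx).2, (hφint y hy).2]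
    constructor <;> intro hh <;> linarith
  obtain ⟨c1, c2⟩ := core
  refine ⟨⟨?_, ?_⟩, ?_⟩
  · rintro ⟨x, hx, y, hy, hxy, h1, h2⟩
    exact c1.1 ⟨x, hx, y, hy, hxy, (e1 x hx y hy hxy).1 h1, (e2 x hx y hy hxy).1 h2⟩
  · intro hh
    obtain ⟨x, hx, y, hy, hxy, h1, h2⟩ := c1.2 hh
    exact ⟨x, hx, y, hy, hxy, (e1 x hx y hy hxy).2 h1, (e2 x hx y hy hxy).2 h2⟩
  · intro x hx y hy hxy h1 h2
    obtain ⟨l1, l2, l3⟩ := c2 x hx y hy hxy ((e1 x hx y hy hxy).1 h1) ((e2 x hx y hy hxy).1 h2)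
    refine ⟨l1, l2, fun x' hx' y' hy' hxy' h1' h2' => ?_⟩
    exact l3 x' hx' y' hy' hxy' ((e1 x' hx' y' hy' hxy').1 h1') ((e2 x' hx' y' hy' hxy').1 h2')
end

section
/- For every x ∈ O: if the set {ξ ∈ O | h(ξ) < −ρq⁺} is nonempty, then there exists exactly one y ∈ O with x < y and L₁(x,y) = 0, and this y satisfies h(y) < −ρq⁺; if instead h(ξ) ≥ −ρq⁺ for every ξ ∈ O, then L₁(x,y) > 0 for every y ∈ O with y > x. -/
open MeasureTheory

/-- nonintegrability forces the partial integrals to be unbounded -/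
theorem aux_unbdd (O : Set ℝ) (hO : IsOpen O) (hOc : O.OrdConnected) (hOne : O.Nonempty)
    (g : ℝ → ℝ) (hg : ∀ d ∈ O, 0 < g d)
    (hi : ∀ d ∈ O, IntegrableOn g (O ∩ Set.Iio d))
    (hn : ¬ IntegrableOn g O) (C : ℝ) : ∃ y ∈ O, C < ∫ ξ in O ∩ Set.Iio y, g ξ := by
  by_contra! hcon
  apply hn
  haveI := hOc
  haveI : Nonempty O := hOne.to_subtype
  have hnext : ∀ a ∈ O, ∃ b ∈ O, a < b := by
    intro a ha
    obtain ⟨ε, hε, hb⟩ := Metric.isOpen_iff.1 hO a ha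
    refine ⟨a + ε / 2, hb ?_, by linarith⟩
    rw [Metric.mem_ball, Real.dist_eq]
    rw [abs_lt]; constructor <;> linarith
  have hcov : AECover (volume.restrict O) (Filter.atTop : Filter O)
      (fun y : O => Set.Iio (y : ℝ)) := by
    refine ⟨?_, fun _ => measurableSet_Iio⟩
    filter_upwards [ae_restrict_mem hO.measurableSet] with a ha
    obtain ⟨b, hb, hab⟩ := hnext a ha
    filter_upwards [Filter.eventually_ge_atTop (⟨b, hb⟩ : O)] with y hy
    exact lt_of_lt_of_le hab hy
  refine hcov.integrable_of_integral_norm_bounded C ?_ ?_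
  · intro y
    have := hi y y.2
    rw [IntegrableOn, Measure.restrict_restrict measurableSet_Iio, Set.inter_comm]
    exact this
  · refine Filter.Eventually.of_forall fun y => ?_
    rw [Measure.restrict_restrict measurableSet_Iio, Set.inter_comm]
    refine le_trans (le_of_eq ?_) (hcon y y.2)
    refine setIntegral_congr_fun (hO.measurableSet.inter measurableSet_Iio) ?_
    intro a ha
    exact abs_of_pos (hg a ha.1)

theorem aux_pos (O : Set ℝ) (hO : IsOpen O)
    (g : ℝ → ℝ) (hg : ∀ d ∈ O, 0 < g d) (d : ℝ) (hd : d ∈ O)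
    (hi : IntegrableOn g (O ∩ Set.Iio d)) : 0 < ∫ ξ in O ∩ Set.Iio d, g ξ := by
  have hms := hO.measurableSet.inter (measurableSet_Iio (a := d))
  rw [setIntegral_pos_iff_support_of_nonneg_ae]
  · obtain ⟨ε, hε, hb⟩ := Metric.isOpen_iff.1 hO d hd
    have hop : IsOpen (O ∩ Set.Iio d) := hO.inter isOpen_Iio
    have hne : (O ∩ Set.Iio d).Nonempty := by
      refine ⟨d - ε / 2, hb ?_, by simp [hε]⟩
      rw [Metric.mem_ball, Real.dist_eq, abs_lt]; constructor <;> linarith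
    refine lt_of_lt_of_le (hop.measure_pos volume hne) (measure_mono ?_)
    exact fun a ha => ⟨(hg a ha.1).ne', ha⟩
  · filter_upwards [ae_restrict_mem hms] with a ha using (hg a ha.1).le
  · exact hi

theorem aux_split (O : Set ℝ) (hO : IsOpen O) (hOc : O.OrdConnected)
    (g : ℝ → ℝ) (x y : ℝ) (hx : x ∈ O) (hy : y ∈ O) (hxy : x ≤ y)
    (hi : ∀ d ∈ O, IntegrableOn g (O ∩ Set.Iio d)) :
    ∫ ξ in O ∩ Set.Iio y, g ξ = (∫ ξ in O ∩ Set.Iio x, g ξ) + ∫ ξ in x..y, g ξ := by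
  have hsub : Set.Ico x y ⊆ O ∩ Set.Iio y :=
    fun a ha => ⟨hOc.out hx hy ⟨ha.1, ha.2.le⟩, ha.2⟩
  have hU : O ∩ Set.Iio y = (O ∩ Set.Iio x) ∪ Set.Ico x y := by
    ext a
    constructor
    · rintro ⟨h1, h2⟩
      rcases lt_or_ge a x with h3 | h3
      · exact Or.inl ⟨h1, h3⟩
      · exact Or.inr ⟨h3, h2⟩
    · rintro (⟨h1, h2⟩ | h1)
      · exact ⟨h1, lt_of_lt_of_le h2 hxy⟩
      · exact hsub h1
  rw [hU, setIntegral_union ?_ measurableSet_Ico (hi x hx) ((hi y hy).mono_set hsub),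
    intervalIntegral.integral_of_le hxy, integral_Ico_eq_integral_Ioc]
  rw [Set.disjoint_left]
  rintro a ⟨_, h1⟩ h2
  exact absurd h2.1 (not_le.2 h1)

/-- first step in the proof of Proposition 5.3 of Federico–Pham.
In the setting of the increasing fundamental solution `ψ` on the open interval `O`, with
scale density `S'`, speed density `m'`, the resolvent identity
`ψ'/S' = ρ ∫_{O∩(-∞,·)} ψ m'`, non-integrability of `ψ m'` on `O`, and `h` continuous and
strictly decreasing with `ψ h m'` integrable near the lower boundary: for every `x ∈ O`,
if `{ξ ∈ O | h ξ < -ρq⁺}` is nonempty then the equation `L₁(x, ·) = 0` has exactly one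
solution `y ∈ O` with `x < y`, and this `y` satisfies `h y < -ρq⁺`; while if
`h ≥ -ρq⁺` on `O` then `L₁(x,y) > 0` for every `y ∈ O` with `x < y`. -/
theorem stmt12
    (O : Set ℝ) (hO : IsOpen O) (hOc : O.OrdConnected) (hOne : O.Nonempty)
    (ρ qp qm : ℝ) (hρ : 0 < ρ) (hqp : 0 < qp) (hqm : 0 < qm)
    (ψ S' m' h : ℝ → ℝ)
    (hψd : DifferentiableOn ℝ ψ O) (hψpos : ∀ d ∈ O, 0 < ψ d) (hψmono : StrictMonoOn ψ O)
    (hS'c : ContinuousOn S' O) (hS'pos : ∀ d ∈ O, 0 < S' d)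
    (hm'c : ContinuousOn m' O) (hm'pos : ∀ d ∈ O, 0 < m' d)
    (hψint : ∀ d ∈ O, IntegrableOn (fun ξ => ψ ξ * m' ξ) (O ∩ Set.Iio d) ∧
      deriv ψ d / S' d = ρ * ∫ ξ in O ∩ Set.Iio d, ψ ξ * m' ξ)
    (hψnonint : ¬ IntegrableOn (fun ξ => ψ ξ * m' ξ) O)
    (hhc : ContinuousOn h O) (hhanti : StrictAntiOn h O)
    (hhint : ∀ d ∈ O, IntegrableOn (fun ξ => ψ ξ * h ξ * m' ξ) (O ∩ Set.Iio d)) :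
    ∀ x ∈ O,
      ({ξ ∈ O | h ξ < -(ρ * qp)}.Nonempty →
        ∃ y ∈ O, x < y ∧ FPL1 ψ S' m' h qm qp x y = 0 ∧ h y < -(ρ * qp) ∧
          ∀ y' ∈ O, x < y' → FPL1 ψ S' m' h qm qp x y' = 0 → y' = y) ∧
      ((∀ ξ ∈ O, -(ρ * qp) ≤ h ξ) →
        ∀ y ∈ O, x < y → 0 < FPL1 ψ S' m' h qm qp x y) := by
  intro x hx
  set g : ℝ → ℝ := fun ξ => ψ ξ * m' ξ with hgdef
  set f : ℝ → ℝ := fun ξ => ψ ξ * h ξ * m' ξ + (ρ * qp) * (ψ ξ * m' ξ) with hfdef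
  have hg : ∀ d ∈ O, 0 < g d := fun d hd => mul_pos (hψpos d hd) (hm'pos d hd)
  have hf : ∀ d, f d = g d * (h d + ρ * qp) := fun d => by simp only [hfdef, hgdef]; ring
  have hgc : ContinuousOn g O := hψd.continuousOn.mul hm'c
  have hkc : ContinuousOn (fun ξ => ψ ξ * h ξ * m' ξ) O :=
    (hψd.continuousOn.mul hhc).mul hm'c
  have hfc : ContinuousOn f O := hkc.add (hgc.const_smul (ρ * qp))
  have hII : ∀ k : ℝ → ℝ, ContinuousOn k O → ∀ a ∈ O, ∀ b ∈ O,
      IntervalIntegrable k volume a b := fun k hk a ha b hb =>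
    (hk.mono (hOc.uIcc_subset ha hb)).intervalIntegrable
  set K : ℝ := (qm + qp) * (ρ * ∫ ξ in O ∩ Set.Iio x, g ξ) with hK
  have hKpos : 0 < K := by
    have := aux_pos O hO g hg x hx (hψint x hx).1
    positivity
  have hL : ∀ y ∈ O, x < y → FPL1 ψ S' m' h qm qp x y = (∫ ξ in x..y, f ξ) + K := by
    intro y hy hxy
    have h1 := aux_split O hO hOc g x y hx hy hxy.le (fun d hd => (hψint d hd).1)
    have h2 : ∫ ξ in x..y, f ξ = (∫ ξ in x..y, ψ ξ * h ξ * m' ξ)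
        + (ρ * qp) * ∫ ξ in x..y, g ξ := by
      rw [← intervalIntegral.integral_const_mul]
      exact intervalIntegral.integral_add (hII _ hkc x hx y hy)
        ((hII _ hgc x hx y hy).const_mul _)
    rw [FPL1, mul_div_assoc, mul_div_assoc, (hψint x hx).2, (hψint y hy).2, h1, h2, hK]
    ring
  have hposs : ∀ y ∈ O, x < y → -(ρ * qp) ≤ h y → 0 < FPL1 ψ S' m' h qm qp x y := by
    intro y hy hxy hh
    rw [hL y hy hxy]
    have : 0 ≤ ∫ ξ in x..y, f ξ := by
      refine intervalIntegral.integral_nonneg hxy.le fun u hu => ?_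
      have huO := hOc.out hx hy hu
      rw [hf]
      have := hhanti.antitoneOn huO hy hu.2
      exact mul_nonneg (hg u huO).le (by linarith)
    linarith
  refine ⟨?_, fun hall y hy hxy => hposs y hy hxy (hall y hy)⟩
  rintro ⟨ξ0, hξ0, hhξ0⟩
  -- strict decrease of the integral past the threshold
  have hdec : ∀ a ∈ O, ∀ b ∈ O, a ≤ b → h a < -(ρ * qp) →
      ∫ ξ in a..b, f ξ ≤ (h a + ρ * qp) * ∫ ξ in a..b, g ξ := by
    intro a ha b hb hab hha
    rw [← intervalIntegral.integral_const_mul]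
    refine intervalIntegral.integral_mono_on hab (hII f hfc a ha b hb)
      ((hII g hgc a ha b hb).const_mul _) fun u hu => ?_
    have huO := hOc.out ha hb hu
    rw [hf, mul_comm]
    have := hhanti.antitoneOn ha huO hu.1
    exact mul_le_mul_of_nonneg_right (by linarith) (hg u huO).le
  have hgpos : ∀ a ∈ O, ∀ b ∈ O, a < b → 0 < ∫ ξ in a..b, g ξ := by
    intro a ha b hb hab
    exact intervalIntegral.intervalIntegral_pos_of_pos_on (hII g hgc a ha b hb)
      (fun u hu => hg u (hOc.out ha hb ⟨hu.1.le, hu.2.le⟩)) hab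
  have huniq : ∀ a ∈ O, ∀ b ∈ O, x < a → a < b → FPL1 ψ S' m' h qm qp x a = 0 →
      FPL1 ψ S' m' h qm qp x b = 0 → False := by
    intro a ha b hb hxa hab h1 h2
    have hha : h a < -(ρ * qp) := by
      by_contra! hc
      exact absurd h1 (hposs a ha hxa hc).ne'
    rw [hL a ha hxa] at h1
    rw [hL b hb (hxa.trans hab)] at h2
    have h3 := intervalIntegral.integral_add_adjacent_intervals (hII f hfc x hx a ha)
      (hII f hfc a ha b hb)
    have h4 := hdec a ha b hb hab.le hha
    have h5 := mul_neg_of_neg_of_pos (show h a + ρ * qp < 0 by linarith) (hgpos a ha b hb hab)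
    linarith
  obtain ⟨z, hz, hxz, hhz⟩ : ∃ z ∈ O, x ≤ z ∧ h z < -(ρ * qp) := by
    rcases le_total x ξ0 with h1 | h1
    · exact ⟨ξ0, hξ0, h1, hhξ0⟩
    · exact ⟨x, hx, le_rfl, lt_of_le_of_lt (hhanti.antitoneOn hξ0 hx h1) hhξ0⟩
  set A : ℝ := (∫ ξ in x..z, f ξ) + K with hA
  set c : ℝ := -(h z + ρ * qp) with hc
  have hcpos : 0 < c := by linarith
  obtain ⟨w, hw, hwC⟩ := aux_unbdd O hO hOc hOne g hg (fun d hd => (hψint d hd).1) hψnonint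
    ((∫ ξ in O ∩ Set.Iio z, g ξ) + |A| / c)
  have hzw : z < w := by
    by_contra! hwz
    have h1 := aux_split O hO hOc g w z hw hz hwz (fun d hd => (hψint d hd).1)
    have h2 : 0 ≤ ∫ ξ in w..z, g ξ := intervalIntegral.integral_nonneg hwz
      fun u hu => (hg u (hOc.out hw hz hu)).le
    have h3 : 0 ≤ |A| / c := by positivity
    linarith
  have hneg : (∫ ξ in x..w, f ξ) + K < 0 := by
    have h1 := aux_split O hO hOc g z w hz hw hzw.le (fun d hd => (hψint d hd).1)
    have h3 := intervalIntegral.integral_add_adjacent_intervals (hII f hfc x hx z hz)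
      (hII f hfc z hz w hw)
    have h4 := hdec z hz w hw hzw.le hhz
    have h5 : |A| / c < ∫ ξ in z..w, g ξ := by linarith
    rw [div_lt_iff₀ hcpos] at h5
    have h6 := le_abs_self A
    have h7 : (h z + ρ * qp) * (∫ ξ in z..w, g ξ) = -((∫ ξ in z..w, g ξ) * c) := by
      rw [hc]; ring
    linarith
  have hxw : x < w := lt_of_le_of_lt hxz hzw
  have hcont : ContinuousOn (fun y => (∫ ξ in x..y, f ξ) + K) (Set.Icc x w) := by
    have := intervalIntegral.continuousOn_primitive_interval (μ := volume) (f := f) (a := x)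
      (b := w) ((hfc.mono (hOc.uIcc_subset hx hw)).integrableOn_compact isCompact_uIcc)
    rw [Set.uIcc_of_le hxw.le] at this
    exact this.add continuousOn_const
  obtain ⟨y, hy, hy0⟩ := intermediate_value_Icc' hxw.le hcont
    (show (0 : ℝ) ∈ _ from ⟨hneg.le, by simpa using hKpos.le⟩)
  have hyO := hOc.out hx hw hy
  have hxy : x < y := by
    refine lt_of_le_of_ne hy.1 ?_
    rintro rfl
    simp at hy0
    exact hKpos.ne' hy0
  have hLy : FPL1 ψ S' m' h qm qp x y = 0 := by rw [hL y hyO hxy]; exact hy0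
  refine ⟨y, hyO, hxy, hLy, ?_, ?_⟩
  · by_contra! hcc
    exact absurd hLy (hposs y hyO hxy hcc).ne'
  · intro y' hy' hxy' h0
    rcases lt_trichotomy y' y with h1 | h1 | h1
    · exact (huniq y' hy' y hyO hxy' h1 h0 hLy).elim
    · exact h1
    · exact (huniq y hyO y' hy' hxy h1 hLy h0).elim
end

section
/- Let c₁ < c₂ be reals, and for i = 1, 2 let (xᵢ, yᵢ) ∈ O × O with xᵢ < yᵢ satisfy L₁(xᵢ,yᵢ; cᵢ) = 0 and L₂(xᵢ,yᵢ; cᵢ) = 0, where L₁, L₂ are formed with h replaced by h_{cᵢ}(ξ) := cᵢ − β₀(ξ). Then x₁ < x₂ and y₁ < y₂. -/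
open MeasureTheory

theorem aux_forward (a b ρ δ : ℝ) (S m v p : ℝ → ℝ) (hab : a < b) (hρ : 0 < ρ) (hδ : 0 < δ)
    (hS : ∀ t ∈ Set.Icc a b, 0 < S t) (hm : ∀ t ∈ Set.Icc a b, 0 < m t)
    (hv : ∀ t ∈ Set.Icc a b, HasDerivAt v (S t * p t) t)
    (hp : ∀ t ∈ Set.Icc a b, HasDerivAt p ((ρ * v t + δ) * m t) t)
    (hva : 0 ≤ v a) (hpa : 0 ≤ p a) : 0 < v b ∧ 0 < p b := by
  have hvc : ContinuousOn v (Set.Icc a b) := fun t ht => (hv t ht).continuousAt.continuousWithinAt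
  have hpc : ContinuousOn p (Set.Icc a b) := fun t ht => (hp t ht).continuousAt.continuousWithinAt
  have key : ∀ c ∈ Set.Icc a b, a < c → (∀ t ∈ Set.Ioo a c, 0 < ρ * v t + δ) →
      0 < v c ∧ 0 < p c := by
    intro c hc hac hpos
    have hsub : Set.Icc a c ⊆ Set.Icc a b := Set.Icc_subset_Icc le_rfl hc.2
    have hpm : StrictMonoOn p (Set.Icc a c) := by
      apply strictMonoOn_of_deriv_pos (convex_Icc a c) (hpc.mono hsub)
      intro t ht
      rw [interior_Icc] at ht
      have ht' := hsub (Set.Ioo_subset_Icc_self ht)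
      rw [(hp t ht').deriv]
      exact mul_pos (hpos t ht) (hm t ht')
    have hvm : StrictMonoOn v (Set.Icc a c) := by
      apply strictMonoOn_of_deriv_pos (convex_Icc a c) (hvc.mono hsub)
      intro t ht
      rw [interior_Icc] at ht
      have ht' := hsub (Set.Ioo_subset_Icc_self ht)
      rw [(hv t ht').deriv]
      have := hpm (Set.left_mem_Icc.2 hac.le) (Set.Ioo_subset_Icc_self ht) ht.1
      exact mul_pos (hS t ht') (by linarith)
    have h1 := hpm (Set.left_mem_Icc.2 hac.le) (Set.right_mem_Icc.2 hac.le) hac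
    have h2 := hvm (Set.left_mem_Icc.2 hac.le) (Set.right_mem_Icc.2 hac.le) hac
    exact ⟨by linarith, by linarith⟩
  refine key b (Set.right_mem_Icc.2 hab.le) hab ?_
  by_contra hcon
  push Not at hcon
  obtain ⟨t, ht, hvt⟩ := hcon
  have hcomp : IsCompact (Set.Icc a b ∩ (fun t => ρ * v t + δ) ⁻¹' Set.Iic 0) :=
    isCompact_Icc.of_isClosed_subset
      (((hvc.const_mul ρ).add_const δ).preimage_isClosed_of_isClosed isClosed_Icc isClosed_Iic)
      Set.inter_subset_left
  obtain ⟨c, ⟨hc, hvc0⟩, hmin⟩ := hcomp.exists_isLeast ⟨t, Set.Ioo_subset_Icc_self ht, hvt⟩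
  have hvc0' : ρ * v c + δ ≤ 0 := hvc0
  have hac : a < c := by
    rcases hc.1.lt_or_eq with h | h
    · exact h
    · subst h
      nlinarith [mul_nonneg hρ.le hva]
  have := (key c hc hac (by
    intro s hs
    by_contra hs'
    have := hmin ⟨⟨hs.1.le, hs.2.le.trans hc.2⟩, (not_lt.1 hs' : ρ * v s + δ ≤ 0)⟩
    exact absurd hs.2 (not_lt.2 this))).1
  nlinarith [mul_pos hρ this]

theorem aux_backward (a b ρ δ : ℝ) (S m v p : ℝ → ℝ) (hab : a < b) (hρ : 0 < ρ) (hδ : 0 < δ)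
    (hS : ∀ t ∈ Set.Icc a b, 0 < S t) (hm : ∀ t ∈ Set.Icc a b, 0 < m t)
    (hv : ∀ t ∈ Set.Icc a b, HasDerivAt v (S t * p t) t)
    (hp : ∀ t ∈ Set.Icc a b, HasDerivAt p ((ρ * v t + δ) * m t) t)
    (hvb : 0 ≤ v b) (hpb : p b ≤ 0) : 0 < v a := by
  have hmem : ∀ t ∈ Set.Icc (-b) (-a), -t ∈ Set.Icc a b := fun t ht =>
    ⟨by linarith [ht.2], by linarith [ht.1]⟩
  have := (aux_forward (-b) (-a) ρ δ (fun t => S (-t)) (fun t => m (-t)) (fun t => v (-t))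
    (fun t => -p (-t)) (by linarith) hρ hδ (fun t ht => hS _ (hmem t ht))
    (fun t ht => hm _ (hmem t ht))
    (fun t ht => by
      have := (hv _ (hmem t ht)).comp t (hasDerivAt_neg t)
      refine HasDerivAt.congr_deriv (this) ?_
      ring)
    (fun t ht => by
      have := ((hp _ (hmem t ht)).comp t (hasDerivAt_neg t)).neg
      refine HasDerivAt.congr_deriv (this) ?_
      ring) (by simpa using hvb) (by simpa using hpb)).1
  simpa using this

theorem aux_shape (x y ρ : ℝ) (S m u w h : ℝ → ℝ) (hρ : 0 < ρ)
    (hS : ∀ t ∈ Set.Icc x y, 0 < S t) (hm : ∀ t ∈ Set.Icc x y, 0 < m t)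
    (hh : StrictAntiOn h (Set.Icc x y))
    (hu : ∀ t ∈ Set.Icc x y, HasDerivAt u (S t * w t) t)
    (hw : ∀ t ∈ Set.Icc x y, HasDerivAt w ((ρ * u t + h t) * m t) t)
    (hwx : w x = 0) (hwy : w y = 0) : ∀ t ∈ Set.Icc x y, 0 ≤ w t := by
  have huc : ContinuousOn u (Set.Icc x y) := fun t ht => (hu t ht).continuousAt.continuousWithinAt
  have hwc : ContinuousOn w (Set.Icc x y) := fun t ht => (hw t ht).continuousAt.continuousWithinAt
  intro z hz
  by_contra hwz
  push Not at hwz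
  have hs1 : Set.Icc x z ⊆ Set.Icc x y := Set.Icc_subset_Icc le_rfl hz.2
  have hs2 : Set.Icc z y ⊆ Set.Icc x y := Set.Icc_subset_Icc hz.1 le_rfl
  have hc1 : IsCompact (Set.Icc x z ∩ w ⁻¹' Set.Ici 0) :=
    isCompact_Icc.of_isClosed_subset
      ((hwc.mono hs1).preimage_isClosed_of_isClosed isClosed_Icc isClosed_Ici)
      Set.inter_subset_left
  have hc2 : IsCompact (Set.Icc z y ∩ w ⁻¹' Set.Ici 0) :=
    isCompact_Icc.of_isClosed_subset
      ((hwc.mono hs2).preimage_isClosed_of_isClosed isClosed_Icc isClosed_Ici)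
      Set.inter_subset_left
  obtain ⟨a, ⟨ha, hwa⟩, hamax⟩ := hc1.exists_isGreatest
    ⟨x, Set.left_mem_Icc.2 hz.1, by simp [hwx]⟩
  obtain ⟨b, ⟨hb, hwb⟩, hbmin⟩ := hc2.exists_isLeast
    ⟨y, Set.right_mem_Icc.2 hz.2, by simp [hwy]⟩
  have hwa' : 0 ≤ w a := hwa
  have hwb' : 0 ≤ w b := hwb
  have haz : a < z := by
    rcases ha.2.lt_or_eq with h | h
    · exact h
    · subst h; linarith
  have hzb : z < b := by
    rcases hb.1.lt_or_eq with h | h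
    · exact h
    · subst h; linarith
  have hneg : ∀ t ∈ Set.Ioo a b, w t < 0 := by
    intro t ht
    by_contra hcon
    push Not at hcon
    rcases le_total t z with h | h
    · exact absurd (hamax ⟨⟨ha.1.trans ht.1.le, h⟩, hcon⟩) (not_le.2 ht.1)
    · exact absurd (hbmin ⟨⟨h, ht.2.le.trans hb.2⟩, hcon⟩) (not_le.2 ht.2)
  have hab : Set.Icc a b ⊆ Set.Icc x y := Set.Icc_subset_Icc ha.1 hb.2
  have huanti : StrictAntiOn u (Set.Icc a b) := by
    apply strictAntiOn_of_deriv_neg (convex_Icc a b) (huc.mono hab)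
    intro t ht
    rw [interior_Icc] at ht
    have ht' := hab (Set.Ioo_subset_Icc_self ht)
    rw [(hu t ht').deriv]
    exact mul_neg_of_pos_of_neg (hS t ht') (hneg t ht)
  have haz' : Set.Icc a z ⊆ Set.Icc x y := Set.Icc_subset_Icc ha.1 hz.2
  have hzb' : Set.Icc z b ⊆ Set.Icc x y := Set.Icc_subset_Icc hz.1 hb.2
  obtain ⟨t₁, ht₁, he₁⟩ := exists_hasDerivAt_eq_slope w (fun t => (ρ * u t + h t) * m t) haz
    (hwc.mono haz') (fun t ht => hw t (haz' (Set.Ioo_subset_Icc_self ht)))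
  obtain ⟨t₂, ht₂, he₂⟩ := exists_hasDerivAt_eq_slope w (fun t => (ρ * u t + h t) * m t) hzb
    (hwc.mono hzb') (fun t ht => hw t (hzb' (Set.Ioo_subset_Icc_self ht)))
  have h1 : (ρ * u t₁ + h t₁) * m t₁ < 0 := by
    rw [he₁]; exact div_neg_of_neg_of_pos (by linarith) (by linarith)
  have h2 : 0 < (ρ * u t₂ + h t₂) * m t₂ := by
    rw [he₂]; exact div_pos (by linarith) (by linarith)
  have hm1 := hm t₁ (haz' (Set.Ioo_subset_Icc_self ht₁))
  have hm2 := hm t₂ (hzb' (Set.Ioo_subset_Icc_self ht₂))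
  have g1 : ρ * u t₁ + h t₁ < 0 := by
    by_contra hc; push Not at hc; nlinarith [mul_nonneg hc hm1.le]
  have g2 : 0 < ρ * u t₂ + h t₂ := (pos_iff_pos_of_mul_pos h2).2 hm2
  have h12 : t₁ < t₂ := ht₁.2.trans ht₂.1
  have i1 := hh (haz' (Set.Ioo_subset_Icc_self ht₁)) (hzb' (Set.Ioo_subset_Icc_self ht₂)) h12
  have i2 := huanti (a := t₁) (b := t₂) ⟨ht₁.1.le, (ht₁.2.trans hzb).le⟩
    ⟨(haz.trans ht₂.1).le, ht₂.2.le⟩ h12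
  nlinarith [mul_lt_mul_of_pos_left i2 hρ]

theorem aux_deriv_left (x y d : ℝ) (w : ℝ → ℝ) (hxy : x < y) (hd : HasDerivAt w d x)
    (hwx : w x = 0) (hw : ∀ t ∈ Set.Icc x y, 0 ≤ w t) : 0 ≤ d := by
  have h := hd.hasDerivWithinAt (s := Set.Ioi x)
  rw [hasDerivWithinAt_iff_tendsto_slope' (by simp)] at h
  refine ge_of_tendsto h ?_
  filter_upwards [Ioo_mem_nhdsGT hxy] with t ht
  rw [slope_def_field, hwx]
  exact div_nonneg (by linarith [hw t (Set.Ioo_subset_Icc_self ht)]) (by linarith [ht.1])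

theorem aux_deriv_right (x y d : ℝ) (w : ℝ → ℝ) (hxy : x < y) (hd : HasDerivAt w d y)
    (hwy : w y = 0) (hw : ∀ t ∈ Set.Icc x y, 0 ≤ w t) : d ≤ 0 := by
  have h := hd.hasDerivWithinAt (s := Set.Iio y)
  rw [hasDerivWithinAt_iff_tendsto_slope' (by simp)] at h
  refine le_of_tendsto h ?_
  filter_upwards [Ioo_mem_nhdsLT hxy] with t ht
  rw [slope_def_field, hwy]
  exact div_nonpos_of_nonneg_of_nonpos (by linarith [hw t (Set.Ioo_subset_Icc_self ht)])
    (by linarith [ht.2])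

theorem aux_int_deriv (O : Set ℝ) (hO : IsOpen O) (hOc : O.OrdConnected) (f : ℝ → ℝ)
    (hf : ContinuousOn f O) (a z : ℝ) (ha : a ∈ O) (hz : z ∈ O) :
    HasDerivAt (fun t => ∫ ξ in a..t, f ξ) (f z) z := by
  apply intervalIntegral.integral_hasDerivAt_right
  · exact (hf.mono (hOc.uIcc_subset ha hz)).intervalIntegrable
  · exact hf.stronglyMeasurableAtFilter hO z hz
  · exact hf.continuousAt (hO.mem_nhds hz)

theorem aux_Iio (O : Set ℝ) (hO : IsOpen O) (hOc : O.OrdConnected) (f : ℝ → ℝ)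
    (hf : ContinuousOn f O) (hint : ∀ d ∈ O, IntegrableOn f (O ∩ Set.Iio d)) (z : ℝ) (hz : z ∈ O) :
    HasDerivAt (fun t => ∫ ξ in O ∩ Set.Iio t, f ξ) (f z) z := by
  have h1 := (aux_int_deriv O hO hOc f hf z z hz hz).const_add (∫ ξ in O ∩ Set.Iio z, f ξ)
  refine h1.congr_of_eventuallyEq ?_
  have key : ∀ a ∈ O, ∀ b ∈ O, a ≤ b → (∫ ξ in O ∩ Set.Iio b, f ξ)
      = (∫ ξ in O ∩ Set.Iio a, f ξ) + ∫ ξ in a..b, f ξ := by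
    intro a ha b hb hab
    have hset : O ∩ Set.Iio b = (O ∩ Set.Iio a) ∪ Set.Ico a b := by
      ext t
      constructor
      · rintro ⟨h1, h2⟩
        rcases lt_or_ge t a with h | h
        · exact Or.inl ⟨h1, h⟩
        · exact Or.inr ⟨h, h2⟩
      · rintro (⟨h1, h2⟩ | h)
        · exact ⟨h1, lt_of_lt_of_le h2 hab⟩
        · exact ⟨hOc.out ha hb ⟨h.1, h.2.le⟩, h.2⟩
    have hi : IntegrableOn f (Set.Ico a b) :=
      (hint b hb).mono_set (by rw [hset]; exact Set.subset_union_right)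
    rw [hset, setIntegral_union _ measurableSet_Ico (hint a ha) hi,
      intervalIntegral.integral_of_le hab, integral_Ico_eq_integral_Ioc]
    rw [Set.disjoint_left]
    rintro t ⟨_, h1⟩ ⟨h2, _⟩
    exact absurd h1 (not_lt.2 h2)
  filter_upwards [hO.mem_nhds hz] with t ht
  rcases le_total z t with h | h
  · exact key z hz t ht h
  · rw [key t ht z hz h, intervalIntegral.integral_symm t z]; ring

theorem aux_Ioi (O : Set ℝ) (hO : IsOpen O) (hOc : O.OrdConnected) (f : ℝ → ℝ)
    (hf : ContinuousOn f O) (hint : ∀ d ∈ O, IntegrableOn f (O ∩ Set.Ioi d)) (z : ℝ) (hz : z ∈ O) :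
    HasDerivAt (fun t => -∫ ξ in O ∩ Set.Ioi t, f ξ) (f z) z := by
  have h1 := (aux_int_deriv O hO hOc f hf z z hz hz).const_add (-∫ ξ in O ∩ Set.Ioi z, f ξ)
  refine h1.congr_of_eventuallyEq ?_
  have key : ∀ a ∈ O, ∀ b ∈ O, a ≤ b → (∫ ξ in O ∩ Set.Ioi a, f ξ)
      = (∫ ξ in O ∩ Set.Ioi b, f ξ) + ∫ ξ in a..b, f ξ := by
    intro a ha b hb hab
    have hset : O ∩ Set.Ioi a = (O ∩ Set.Ioi b) ∪ Set.Ioc a b := by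
      ext t
      constructor
      · rintro ⟨h1, h2⟩
        rcases lt_or_ge b t with h | h
        · exact Or.inl ⟨h1, h⟩
        · exact Or.inr ⟨h2, h⟩
      · rintro (⟨h1, h2⟩ | h)
        · exact ⟨h1, lt_of_le_of_lt hab h2⟩
        · exact ⟨hOc.out ha hb ⟨h.1.le, h.2⟩, h.1⟩
    have hi : IntegrableOn f (Set.Ioc a b) :=
      (hint a ha).mono_set (by rw [hset]; exact Set.subset_union_right)
    rw [hset, setIntegral_union _ measurableSet_Ioc (hint b hb) hi,
      intervalIntegral.integral_of_le hab]
    rw [Set.disjoint_left]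
    rintro t ⟨_, h1⟩ ⟨_, h2⟩
    exact absurd h1 (not_lt.2 h2)
  filter_upwards [hO.mem_nhds hz] with t ht
  rcases le_total z t with h | h
  · rw [key z hz t ht h]; ring
  · rw [key t ht z hz h, intervalIntegral.integral_symm t z]; ring

theorem aux_exists (O : Set ℝ) (hO : IsOpen O) (hOc : O.OrdConnected) (ρ qm qp : ℝ)
    (ψ φ P Q S m h : ℝ → ℝ)
    (hψ : ∀ z ∈ O, HasDerivAt ψ (S z * P z) z) (hφ : ∀ z ∈ O, HasDerivAt φ (S z * Q z) z)
    (hP : ∀ z ∈ O, HasDerivAt P (ρ * (ψ z * m z)) z)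
    (hQ : ∀ z ∈ O, HasDerivAt Q (ρ * (φ z * m z)) z)
    (hD : ∀ z ∈ O, 0 < φ z * P z - ψ z * Q z)
    (hm : ContinuousOn m O) (hh : ContinuousOn h O)
    (x y : ℝ) (hx : x ∈ O) (hy : y ∈ O)
    (h1 : (∫ ξ in x..y, ψ ξ * h ξ * m ξ) + qm * P x + qp * P y = 0)
    (h2 : (∫ ξ in x..y, φ ξ * h ξ * m ξ) + qm * Q x + qp * Q y = 0) :
    ∃ u w : ℝ → ℝ, (∀ z ∈ O, HasDerivAt u (S z * w z) z) ∧
      (∀ z ∈ O, HasDerivAt w ((ρ * u z + h z) * m z) z) ∧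
      u x = -qm ∧ w x = 0 ∧ u y = qp ∧ w y = 0 := by
  have hψc : ContinuousOn ψ O := fun t ht => (hψ t ht).continuousAt.continuousWithinAt
  have hφc : ContinuousOn φ O := fun t ht => (hφ t ht).continuousAt.continuousWithinAt
  have hDd : ∀ z ∈ O, HasDerivAt (fun z => φ z * P z - ψ z * Q z) 0 z := by
    intro z hz
    have := ((hφ z hz).mul (hP z hz)).sub ((hψ z hz).mul (hQ z hz))
    refine HasDerivAt.congr_deriv (this) ?_
    ring
  have hDc : φ y * P y - ψ y * Q y = φ x * P x - ψ x * Q x := by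
    have := hOc.convex.is_const_of_fderivWithin_eq_zero (𝕜 := ℝ)
      (f := fun z => φ z * P z - ψ z * Q z)
      (fun z hz => (hDd z hz).differentiableAt.differentiableWithinAt)
      (fun z hz => by
        rw [fderivWithin_of_isOpen hO hz]
        ext
        simp [(hDd z hz).deriv]) hy hx
    exact this
  have hDx := hD x hx
  obtain ⟨D, hDdef⟩ : ∃ D, D = φ x * P x - ψ x * Q x := ⟨_, rfl⟩
  rw [← hDdef] at hDx hDc
  have hD0 : D ≠ 0 := hDx.ne'
  let A : ℝ → ℝ := fun z => (∫ ξ in x..z, ψ ξ * h ξ * m ξ) + qm * P x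
  let B : ℝ → ℝ := fun z => (∫ ξ in x..z, φ ξ * h ξ * m ξ) + qm * Q x
  have hA : ∀ z ∈ O, HasDerivAt A (ψ z * h z * m z) z := fun z hz =>
    (aux_int_deriv O hO hOc _ ((hψc.mul hh).mul hm) x z hx hz).add_const _
  have hB : ∀ z ∈ O, HasDerivAt B (φ z * h z * m z) z := fun z hz =>
    (aux_int_deriv O hO hOc _ ((hφc.mul hh).mul hm) x z hx hz).add_const _
  have hAx : A x = qm * P x := by simp [A]
  have hBx : B x = qm * Q x := by simp [B]
  have hAy : A y = -(qp * P y) := by simp only [A]; linarith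
  have hBy : B y = -(qp * Q y) := by simp only [B]; linarith
  have hDP : ∀ z ∈ O, φ z * P z - ψ z * Q z = D := by
    intro z hz
    have := hOc.convex.is_const_of_fderivWithin_eq_zero (𝕜 := ℝ)
      (f := fun z => φ z * P z - ψ z * Q z)
      (fun z hz => (hDd z hz).differentiableAt.differentiableWithinAt)
      (fun z hz => by
        rw [fderivWithin_of_isOpen hO hz]
        ext
        simp [(hDd z hz).deriv]) hz hx
    rw [hDdef]; exact this
  refine ⟨fun z => (ψ z * B z - φ z * A z) / D, fun z => (P z * B z - Q z * A z) / D,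
    ?_, ?_, ?_, ?_, ?_, ?_⟩
  · intro z hz
    have := (((hψ z hz).mul (hB z hz)).sub ((hφ z hz).mul (hA z hz))).div_const D
    refine HasDerivAt.congr_deriv (this) ?_
    ring
  · intro z hz
    have := (((hP z hz).mul (hB z hz)).sub ((hQ z hz).mul (hA z hz))).div_const D
    refine HasDerivAt.congr_deriv (this) ?_
    have e := hDP z hz
    field_simp
    rw [← e]
    ring
  · simp only [hAx, hBx]
    field_simp
    rw [hDdef]; ring
  · simp only [hAx, hBx]
    field_simp
    ring
  · simp only [hAy, hBy]
    field_simp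
    rw [← hDc]; ring
  · simp only [hAy, hBy]
    field_simp
    ring

/-- strict monotonicity of the boundaries, Proposition 5.3 of
Federico–Pham. In the usual setting of the fundamental solutions `ψ` (positive, strictly
increasing) and `φ` (positive, strictly decreasing) on the open interval `O`, with scale
density `S'`, speed density `m'`, the resolvent identities, non-integrability of `ψ m'`
and `φ m'` on `O`, and `β₀` continuous and strictly increasing on `O` with the stated
integrability: if `c₁ < c₂` and `(xᵢ, yᵢ) ∈ O × O` with `xᵢ < yᵢ` solve
`L₁(xᵢ, yᵢ; cᵢ) = L₂(xᵢ, yᵢ; cᵢ) = 0`, where the marginal cost is `h_c = c - β₀`, then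
`x₁ < x₂` and `y₁ < y₂`. -/
theorem stmt13
    (O : Set ℝ) (hO : IsOpen O) (hOc : O.OrdConnected) (hOne : O.Nonempty)
    (ρ qp qm : ℝ) (hρ : 0 < ρ) (hqp : 0 < qp) (hqm : 0 < qm)
    (ψ φ S' m' β₀ : ℝ → ℝ)
    (hψd : DifferentiableOn ℝ ψ O) (hψpos : ∀ d ∈ O, 0 < ψ d) (hψmono : StrictMonoOn ψ O)
    (hφd : DifferentiableOn ℝ φ O) (hφpos : ∀ d ∈ O, 0 < φ d) (hφanti : StrictAntiOn φ O)
    (hS'c : ContinuousOn S' O) (hS'pos : ∀ d ∈ O, 0 < S' d)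
    (hm'c : ContinuousOn m' O) (hm'pos : ∀ d ∈ O, 0 < m' d)
    (hψint : ∀ d ∈ O, IntegrableOn (fun ξ => ψ ξ * m' ξ) (O ∩ Set.Iio d) ∧
      deriv ψ d / S' d = ρ * ∫ ξ in O ∩ Set.Iio d, ψ ξ * m' ξ)
    (hφint : ∀ d ∈ O, IntegrableOn (fun ξ => φ ξ * m' ξ) (O ∩ Set.Ioi d) ∧
      deriv φ d / S' d = -(ρ * ∫ ξ in O ∩ Set.Ioi d, φ ξ * m' ξ))
    (hψnonint : ¬ IntegrableOn (fun ξ => ψ ξ * m' ξ) O)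
    (hφnonint : ¬ IntegrableOn (fun ξ => φ ξ * m' ξ) O)
    (hβc : ContinuousOn β₀ O) (hβmono : StrictMonoOn β₀ O)
    (hβint : ∀ d ∈ O, IntegrableOn (fun ξ => ψ ξ * β₀ ξ * m' ξ) (O ∩ Set.Iio d) ∧
      IntegrableOn (fun ξ => φ ξ * β₀ ξ * m' ξ) (O ∩ Set.Ioi d))
    (c₁ c₂ : ℝ) (hc : c₁ < c₂)
    (x₁ y₁ x₂ y₂ : ℝ) (hx₁ : x₁ ∈ O) (hy₁ : y₁ ∈ O) (hx₂ : x₂ ∈ O) (hy₂ : y₂ ∈ O)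
    (hxy₁ : x₁ < y₁) (hxy₂ : x₂ < y₂)
    (hL11 : FPL1 ψ S' m' (fun ξ => c₁ - β₀ ξ) qm qp x₁ y₁ = 0)
    (hL21 : FPL2 φ S' m' (fun ξ => c₁ - β₀ ξ) qm qp x₁ y₁ = 0)
    (hL12 : FPL1 ψ S' m' (fun ξ => c₂ - β₀ ξ) qm qp x₂ y₂ = 0)
    (hL22 : FPL2 φ S' m' (fun ξ => c₂ - β₀ ξ) qm qp x₂ y₂ = 0) :
    x₁ < x₂ ∧ y₁ < y₂ := by
  let P : ℝ → ℝ := fun z => ρ * ∫ ξ in O ∩ Set.Iio z, ψ ξ * m' ξ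
  let Q : ℝ → ℝ := fun z => ρ * -∫ ξ in O ∩ Set.Ioi z, φ ξ * m' ξ
  have hPe : ∀ z ∈ O, deriv ψ z / S' z = P z := fun z hz => (hψint z hz).2
  have hQe : ∀ z ∈ O, deriv φ z / S' z = Q z := fun z hz => by
    rw [(hφint z hz).2]; simp only [Q]; ring
  have hψ : ∀ z ∈ O, HasDerivAt ψ (S' z * P z) z := fun z hz => by
    rw [← hPe z hz, mul_div_cancel₀ _ (hS'pos z hz).ne']
    exact ((hψd z hz).differentiableAt (hO.mem_nhds hz)).hasDerivAt
  have hφ : ∀ z ∈ O, HasDerivAt φ (S' z * Q z) z := fun z hz => by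
    rw [← hQe z hz, mul_div_cancel₀ _ (hS'pos z hz).ne']
    exact ((hφd z hz).differentiableAt (hO.mem_nhds hz)).hasDerivAt
  have hP : ∀ z ∈ O, HasDerivAt P (ρ * (ψ z * m' z)) z := fun z hz =>
    (aux_Iio O hO hOc _ (hψd.continuousOn.mul hm'c) (fun d hd => (hψint d hd).1) z hz).const_mul ρ
  have hQ : ∀ z ∈ O, HasDerivAt Q (ρ * (φ z * m' z)) z := fun z hz =>
    (aux_Ioi O hO hOc _ (hφd.continuousOn.mul hm'c) (fun d hd => (hφint d hd).1) z hz).const_mul ρ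
  have hP0 : ∀ z ∈ O, 0 ≤ P z := fun z hz => mul_nonneg hρ.le
    (setIntegral_nonneg (hO.measurableSet.inter measurableSet_Iio)
      (fun t ht => (mul_pos (hψpos t ht.1) (hm'pos t ht.1)).le))
  have hQ0 : ∀ z ∈ O, Q z ≤ 0 := fun z hz => mul_nonpos_of_nonneg_of_nonpos hρ.le
    (neg_nonpos.2 (setIntegral_nonneg (hO.measurableSet.inter measurableSet_Ioi)
      (fun t ht => (mul_pos (hφpos t ht.1) (hm'pos t ht.1)).le)))
  have hPmono : StrictMonoOn P O := by
    apply strictMonoOn_of_deriv_pos hOc.convex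
      (fun t ht => (hP t ht).continuousAt.continuousWithinAt)
    intro t ht
    have ht := interior_subset ht
    rw [(hP t ht).deriv]
    exact mul_pos hρ (mul_pos (hψpos t ht) (hm'pos t ht))
  have hPpos : ∀ z ∈ O, 0 < P z := by
    intro z hz
    obtain ⟨e, he, hball⟩ := Metric.isOpen_iff.1 hO z hz
    have hz' : z - e / 2 ∈ O := hball (by
      rw [Metric.mem_ball, Real.dist_eq, abs_lt]; constructor <;> linarith)
    exact (hP0 _ hz').trans_lt (hPmono hz' hz (by linarith))
  have hD : ∀ z ∈ O, 0 < φ z * P z - ψ z * Q z := fun z hz => by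
    nlinarith [mul_pos (hφpos z hz) (hPpos z hz),
      mul_nonneg (hψpos z hz).le (neg_nonneg.2 (hQ0 z hz))]
  have main : ∀ c x y : ℝ, x ∈ O → y ∈ O → x < y →
      FPL1 ψ S' m' (fun ξ => c - β₀ ξ) qm qp x y = 0 →
      FPL2 φ S' m' (fun ξ => c - β₀ ξ) qm qp x y = 0 →
      ∃ u w : ℝ → ℝ, (∀ z ∈ O, HasDerivAt u (S' z * w z) z) ∧
      (∀ z ∈ O, HasDerivAt w ((ρ * u z + (c - β₀ z)) * m' z) z) ∧
      u x = -qm ∧ w x = 0 ∧ u y = qp ∧ w y = 0 ∧ (∀ t ∈ Set.Icc x y, 0 ≤ w t) ∧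
      (∀ t ∈ Set.Icc x y, -qm ≤ u t ∧ u t ≤ qp) ∧ 0 < c - β₀ x ∧ c - β₀ y < 0 := by
    intro c x y hx hy hxy h1 h2
    have hsub : Set.Icc x y ⊆ O := hOc.out hx hy
    have h1' : (∫ ξ in x..y, ψ ξ * (c - β₀ ξ) * m' ξ) + qm * P x + qp * P y = 0 := by
      rw [← hPe x hx, ← hPe y hy, ← mul_div_assoc, ← mul_div_assoc]; exact h1
    have h2' : (∫ ξ in x..y, φ ξ * (c - β₀ ξ) * m' ξ) + qm * Q x + qp * Q y = 0 := by
      rw [← hQe x hx, ← hQe y hy, ← mul_div_assoc, ← mul_div_assoc]; exact h2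
    obtain ⟨u, w, hu, hw, hux, hwx, huy, hwy⟩ := aux_exists O hO hOc ρ qm qp ψ φ P Q S' m'
      (fun ξ => c - β₀ ξ) hψ hφ hP hQ hD hm'c (continuousOn_const.sub hβc) x y hx hy h1' h2'
    have hwn := aux_shape x y ρ S' m' u w (fun ξ => c - β₀ ξ) hρ
      (fun t ht => hS'pos t (hsub ht)) (fun t ht => hm'pos t (hsub ht))
      (fun s hs t ht hst => by
        have := hβmono (hsub hs) (hsub ht) hst
        simp only
        linarith)
      (fun t ht => hu t (hsub ht)) (fun t ht => hw t (hsub ht)) hwx hwy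
    have humono : MonotoneOn u (Set.Icc x y) := by
      apply monotoneOn_of_deriv_nonneg (convex_Icc x y)
        (fun t ht => (hu t (hsub ht)).continuousAt.continuousWithinAt)
        (fun t ht => (hu t (hsub (interior_subset ht))).differentiableAt.differentiableWithinAt)
      intro t ht
      have ht := interior_subset ht
      rw [(hu t (hsub ht)).deriv]
      exact mul_nonneg (hS'pos t (hsub ht)).le (hwn t ht)
    have e1 := aux_deriv_left x y _ w hxy (hw x hx) hwx hwn
    have e2 := aux_deriv_right x y _ w hxy (hw y hy) hwy hwn
    have e1' := nonneg_of_mul_nonneg_left e1 (hm'pos x hx)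
    have e2' := nonpos_of_mul_nonpos_left e2 (hm'pos y hy)
    rw [hux] at e1'
    rw [huy] at e2'
    refine ⟨u, w, hu, hw, hux, hwx, huy, hwy, hwn, fun t ht => ⟨?_, ?_⟩, ?_, ?_⟩
    · rw [← hux]; exact humono (Set.left_mem_Icc.2 hxy.le) ht ht.1
    · rw [← huy]; exact humono ht (Set.right_mem_Icc.2 hxy.le) ht.2
    · nlinarith [mul_pos hρ hqm]
    · nlinarith [mul_pos hρ hqp]
  obtain ⟨u₁, w₁, hu₁, hw₁, hu₁x, hw₁x, hu₁y, hw₁y, hw₁n, hu₁b, hh₁x, hh₁y⟩ :=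
    main c₁ x₁ y₁ hx₁ hy₁ hxy₁ hL11 hL21
  obtain ⟨u₂, w₂, hu₂, hw₂, hu₂x, hw₂x, hu₂y, hw₂y, hw₂n, hu₂b, hh₂x, hh₂y⟩ :=
    main c₂ x₂ y₂ hx₂ hy₂ hxy₂ hL12 hL22
  have hv : ∀ z ∈ O, HasDerivAt (fun z => u₂ z - u₁ z) (S' z * (w₂ z - w₁ z)) z := by
    intro z hz
    refine HasDerivAt.congr_deriv ((hu₂ z hz).sub (hu₁ z hz)) ?_
    ring
  have hp : ∀ z ∈ O, HasDerivAt (fun z => w₂ z - w₁ z)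
      ((ρ * (u₂ z - u₁ z) + (c₂ - c₁)) * m' z) z := by
    intro z hz
    refine HasDerivAt.congr_deriv ((hw₂ z hz).sub (hw₁ z hz)) ?_
    ring
  have hx : x₁ < x₂ := by
    by_contra hcon
    push Not at hcon
    have hxy : x₁ < y₂ := by
      by_contra hc2
      push Not at hc2
      have := hβmono.monotoneOn hy₂ hx₁ hc2
      linarith
    have hfw : ∀ b ∈ O, x₁ < b → 0 < u₂ b - u₁ b ∧ 0 < w₂ b - w₁ b := by
      intro b hb hab
      have hsub : Set.Icc x₁ b ⊆ O := hOc.out hx₁ hb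
      have m1 : x₁ ∈ Set.Icc x₂ y₂ := ⟨hcon, hxy.le⟩
      exact aux_forward x₁ b ρ (c₂ - c₁) S' m' (fun z => u₂ z - u₁ z) (fun z => w₂ z - w₁ z) hab hρ
        (by linarith) (fun t ht => hS'pos t (hsub ht)) (fun t ht => hm'pos t (hsub ht))
        (fun t ht => hv t (hsub ht)) (fun t ht => hp t (hsub ht))
        (by linarith [(hu₂b x₁ m1).1]) (by linarith [hw₂n x₁ m1])
    rcases le_total y₁ y₂ with h | h
    · have := (hfw y₁ hy₁ hxy₁).1
      linarith [(hu₂b y₁ ⟨hcon.trans hxy₁.le, h⟩).2]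
    · have := (hfw y₂ hy₂ hxy).2
      linarith [hw₁n y₂ ⟨hxy.le, h⟩]
  refine ⟨hx, ?_⟩
  by_contra hcon
  push Not at hcon
  have hsub : Set.Icc x₂ y₂ ⊆ O := hOc.out hx₂ hy₂
  have m1 : y₂ ∈ Set.Icc x₁ y₁ := ⟨(hx.trans hxy₂).le, hcon⟩
  have m2 : x₂ ∈ Set.Icc x₁ y₁ := ⟨hx.le, hxy₂.le.trans hcon⟩
  have := aux_backward x₂ y₂ ρ (c₂ - c₁) S' m' (fun z => u₂ z - u₁ z) (fun z => w₂ z - w₁ z) hxy₂ hρ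
    (by linarith) (fun t ht => hS'pos t (hsub ht)) (fun t ht => hm'pos t (hsub ht))
    (fun t ht => hv t (hsub ht)) (fun t ht => hp t (hsub ht))
    (by linarith [(hu₁b y₂ m1).2]) (by linarith [hw₁n y₂ m1])
  linarith [(hu₁b x₂ m2).1]
end
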